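/- arXiv:1811.11444 — 2 statements merged into one kernel-verified Lean document; each statement's English description precedes it below -/
import Mathlib

section
/- For every integer n ≥ 3, letting h ≥ 0 be the unique integer with 2f_h ≤ n < 2f_{h+1}, the number of distinct squares occurring as factors of the prefix F[1,n] of the Fibonacci word equals min{n − f_{h−1} − 2, f_{h+1} + f_{h−1} − 3}. -/
/-- Fibonacci numbers: `fn 0 = 1`, `fn 1 = 2`, `fn (m+2) = fn (m+1) + fn m`
(so `fn m` is the paper's `f_m`; also `f_{m-1} = Nat.fib (m+1)` etc.). -/
def fn (m : ℕ) : ℕ := Nat.fib (m + 2)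

/-- Finite Fibonacci words `Fw m = σ^m(a)` for the morphism σ(a)=ab, σ(b)=a,
with `a := false`, `b := true`; equivalently `Fw (m+2) = Fw (m+1) ++ Fw m`. -/
def Fw : ℕ → List Bool
  | 0 => [false]
  | 1 => [false, true]
  | m + 2 => Fw (m + 1) ++ Fw m

/-- The infinite Fibonacci word (0-indexed): the fixed point of σ beginning with `a`. -/
def fibWord (i : ℕ) : Bool := (Fw (i + 1)).getD i false

/-- `fFactor i n = F[i;n]`, the factor of length `n` of the Fibonacci word
beginning at (1-indexed) position `i`. -/
def fFactor (i n : ℕ) : List Bool := (List.range n).map fun t => fibWord (i - 1 + t)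

/-- `w` occurs as a factor of the infinite Fibonacci word. -/
def IsFactorF (w : List Bool) : Prop := ∃ i : ℕ, 1 ≤ i ∧ w = fFactor i w.length

/-- `D2 i n`: the number of distinct squares occurring as factors of `F[i;n]`. -/
noncomputable def D2 (i n : ℕ) : ℕ :=
  {w : List Bool | w ≠ [] ∧ (w ++ w) <:+: fFactor i n}.ncard


namespace FibSq

theorem Fw_length : ∀ m, (Fw m).length = Nat.fib (m + 2)
  | 0 => rfl
  | 1 => rfl
  | m + 2 => by
    rw [Fw, List.length_append, Fw_length (m + 1), Fw_length m, Nat.fib_add_two (n := m + 2)]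
    exact add_comm _ _

theorem Fw_pre_succ : ∀ m, Fw m <+: Fw (m + 1)
  | 0 => ⟨[true], rfl⟩
  | m + 1 => by rw [Fw]; exact List.prefix_append _ _

theorem Fw_pre {m m' : ℕ} (h : m ≤ m') : Fw m <+: Fw m' := by
  induction h with
  | refl => exact List.prefix_rfl
  | step _ ih => exact ih.trans (Fw_pre_succ _)

theorem getD_pre {l l' : List Bool} (h : l <+: l') {i : ℕ} (hi : i < l.length) :
    l.getD i false = l'.getD i false := by
  obtain ⟨t, rfl⟩ := h
  rw [List.getD_append _ _ _ _ hi]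

theorem lt_fib (i : ℕ) : i < Nat.fib (i + 3) := by
  induction i with
  | zero => decide
  | succ n ih =>
    have h1 : Nat.fib (n + 1 + 3) = Nat.fib (n + 2) + Nat.fib (n + 3) := Nat.fib_add_two
    have : 0 < Nat.fib (n + 2) := Nat.fib_pos.2 (by omega)
    omega

theorem fibWord_eq {m i : ℕ} (hi : i < Nat.fib (m + 2)) : fibWord i = (Fw m).getD i false := by
  unfold fibWord
  have h1 : i < (Fw (i + 1)).length := by rw [Fw_length]; exact lt_fib i
  have h2 : i < (Fw m).length := by rw [Fw_length]; exact hi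
  rcases le_total m (i + 1) with h | h
  · exact (getD_pre (Fw_pre h) h2).symm
  · exact getD_pre (Fw_pre h) h1

theorem fib3 (k : ℕ) : Nat.fib (k + 2) = Nat.fib k + Nat.fib (k + 1) := Nat.fib_add_two

theorem R (k j : ℕ) (hj : j < Nat.fib (k + 2)) : fibWord (Nat.fib (k + 3) + j) = fibWord j := by
  have e := fib3 (k + 2)
  have h1 : Nat.fib (k + 3) + j < Nat.fib (k + 2 + 2) := by
    have : Nat.fib (k + 2 + 1) = Nat.fib (k + 3) := rfl
    omega
  rw [fibWord_eq h1, fibWord_eq hj, Fw, List.getD_append_right]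
  · rw [Fw_length]; congr 1
    have : Nat.fib (k + 1 + 2) = Nat.fib (k + 3) := rfl
    omega
  · rw [Fw_length]; have : Nat.fib (k + 1 + 2) = Nat.fib (k + 3) := rfl
    omega

theorem F0 : fibWord 0 = false := by decide
theorem F1 : fibWord 1 = true := by decide
theorem F2 : fibWord 2 = false := by decide
theorem F3 : fibWord 3 = false := by decide

theorem MM (k : ℕ) : ∀ j, j < Nat.fib (k + 3) →
    (fibWord (j + Nat.fib (k + 2)) = fibWord j ↔ j + 2 < Nat.fib (k + 3)) := by
  induction k with
  | zero =>
    intro j hj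
    have : Nat.fib (0 + 3) = 2 := rfl
    have : Nat.fib (0 + 2) = 1 := rfl
    have : j = 0 ∨ j = 1 := by omega
    rcases this with rfl | rfl <;> decide
  | succ k ih =>
    intro j hj
    have e1 : Nat.fib (k + 1 + 3) = Nat.fib (k + 2) + Nat.fib (k + 3) := fib3 (k + 2)
    have e2 : Nat.fib (k + 1 + 2) = Nat.fib (k + 3) := rfl
    have e3 : Nat.fib (k + 3) = Nat.fib (k + 1) + Nat.fib (k + 2) := fib3 (k + 1)
    have p1 : 0 < Nat.fib (k + 1) := Nat.fib_pos.2 (by omega)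
    have p2 : 0 < Nat.fib (k + 2) := Nat.fib_pos.2 (by omega)
    rw [e2]
    by_cases hlt : j < Nat.fib (k + 2)
    · have := R k j hlt
      rw [add_comm] at this
      simp only [this, true_iff]; omega
    · obtain ⟨t, rfl⟩ : ∃ t, j = t + Nat.fib (k + 2) := ⟨j - Nat.fib (k + 2), by omega⟩
      have h1 := R (k + 1) t (by rw [e2]; omega)
      have h2 := ih t (by omega)
      have h3 : t + Nat.fib (k + 2) + Nat.fib (k + 3) = Nat.fib (k + 1 + 3) + t := by omega
      rw [h3, h1]
      constructor
      · intro h; have := h2.1 h.symm; omega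
      · intro h; exact (h2.2 (by omega)).symm

theorem M1 (k j : ℕ) (h : j + 2 < Nat.fib (k + 3)) :
    fibWord (j + Nat.fib (k + 2)) = fibWord j := (MM k j (by omega)).2 h

/-- number of letters `a` before position `s` -/
def cnt : ℕ → ℕ
  | 0 => 0
  | s + 1 => cnt s + (if fibWord s = false then 1 else 0)

theorem cnt_a {s : ℕ} (h : fibWord s = false) : cnt (s + 1) = cnt s + 1 := by simp [cnt, h]
theorem cnt_b {s : ℕ} (h : fibWord s = true) : cnt (s + 1) = cnt s := by simp [cnt, h]

theorem cnt_add (k j : ℕ) (hj : j ≤ Nat.fib (k + 2)) :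
    cnt (Nat.fib (k + 3) + j) = cnt (Nat.fib (k + 3)) + cnt j := by
  induction j with
  | zero => rfl
  | succ j ih =>
    have := ih (by omega)
    rw [← add_assoc, cnt, cnt, this, R k j (by omega)]; omega

theorem cnt_fib : ∀ k, cnt (Nat.fib (k + 2)) = Nat.fib (k + 1)
  | 0 => by decide
  | 1 => by decide
  | k + 2 => by
    have e : Nat.fib (k + 2 + 2) = Nat.fib (k + 3) + Nat.fib (k + 2) := by
      rw [fib3 (k + 2)]; exact add_comm _ _
    rw [e, cnt_add k _ le_rfl, cnt_fib k]
    have := cnt_fib (k + 1)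
    rw [this, fib3 (k + 1)]; exact add_comm _ _

def pos (s : ℕ) : ℕ := s + cnt s

theorem pos_a {s : ℕ} (h : fibWord s = false) : pos (s + 1) = pos s + 2 := by
  unfold pos; rw [cnt_a h]; omega
theorem pos_b {s : ℕ} (h : fibWord s = true) : pos (s + 1) = pos s + 1 := by
  unfold pos; rw [cnt_b h]; omega

theorem cnt_mono {s t : ℕ} (h : s ≤ t) : cnt s ≤ cnt t := by
  induction h with
  | refl => rfl
  | step _ ih => rw [cnt]; omega

theorem cnt_le (s d : ℕ) : cnt (s + d) ≤ cnt s + d := by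
  induction d with
  | zero => simp
  | succ d ih => rw [← add_assoc, cnt]; split <;> omega

theorem pos_fib (k : ℕ) : pos (Nat.fib (k + 2)) = Nat.fib (k + 3) := by
  unfold pos; rw [cnt_fib, fib3 (k + 1)]; exact add_comm _ _

theorem exists_fib (s : ℕ) (k0 : ℕ) (hs : Nat.fib (k0 + 2) ≤ s) :
    ∃ k, k0 ≤ k ∧ Nat.fib (k + 2) ≤ s ∧ s < Nat.fib (k + 3) := by
  by_contra hcon
  push Not at hcon
  have : ∀ d, Nat.fib (k0 + d + 2) ≤ s := by
    intro d
    induction d with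
    | zero => exact hs
    | succ d ih => exact hcon (k0 + d) (by omega) ih
  have h1 := this (s + 1)
  have h2 := lt_fib s
  have h3 : Nat.fib (s + 3) ≤ Nat.fib (k0 + (s + 1) + 2) := Nat.fib_mono (by omega)
  omega

theorem pos_spec (s : ℕ) : fibWord (pos s) = false ∧
    (fibWord s = false → fibWord (pos s + 1) = true) ∧
    (fibWord s = true → fibWord (pos s + 1) = false) := by
  induction s using Nat.strong_induction_on with
  | _ s ih =>
    by_cases h0 : s = 0
    · subst h0; decide
    by_cases h1 : s = 1
    · subst h1; decide
    obtain ⟨k, hk, hk1, hk2⟩ := exists_fib s 1 (by have : Nat.fib (1 + 2) = 2 := rfl; omega)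
    obtain ⟨k, rfl⟩ : ∃ k', k = k' + 1 := ⟨k - 1, by omega⟩
    have e1 : Nat.fib (k + 1 + 3) = Nat.fib (k + 2) + Nat.fib (k + 3) := fib3 (k + 2)
    have e2 : Nat.fib (k + 1 + 2) = Nat.fib (k + 3) := rfl
    have e3 : Nat.fib (k + 2 + 3) = Nat.fib (k + 3) + Nat.fib (k + 1 + 3) := fib3 (k + 3)
    have e4 : Nat.fib (k + 3) = Nat.fib (k + 1) + Nat.fib (k + 2) := fib3 (k + 1)
    have e5 : Nat.fib (k + 2 + 2) = Nat.fib (k + 1 + 3) := rfl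
    have p1 : 0 < Nat.fib (k + 1) := Nat.fib_pos.2 (by omega)
    have p2 : 0 < Nat.fib (k + 2) := Nat.fib_pos.2 (by omega)
    obtain ⟨j, rfl⟩ : ∃ j, s = Nat.fib (k + 3) + j := ⟨s - Nat.fib (k + 3), by omega⟩
    have hj : j < Nat.fib (k + 2) := by omega
    have hp : pos (Nat.fib (k + 3) + j) = pos j + Nat.fib (k + 2 + 2) := by
      have h1 := cnt_add k j hj.le
      have h2 := cnt_fib (k + 1)
      have h3 : Nat.fib (k + 1 + 1) = Nat.fib (k + 2) := rfl
      unfold pos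
      rw [e2] at h2
      omega
    have hpj : pos j + 1 ≤ Nat.fib (k + 3) := by
      have h1 := pos_fib k
      unfold pos at *
      have := cnt_mono hj.le
      omega
    have hij := ih j (by omega)
    rw [hp, R k j hj]
    have g1 := M1 (k + 2) (pos j) (by omega)
    have g2 := M1 (k + 2) (pos j + 1) (by omega)
    have g3 : pos j + Nat.fib (k + 2 + 2) + 1 = pos j + 1 + Nat.fib (k + 2 + 2) := by omega
    rw [g3, g1, g2]
    exact hij

theorem cnt_pos (s : ℕ) : cnt (pos s) = s := by
  induction s with
  | zero => rfl
  | succ s ih =>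
    obtain ⟨h1, h2, h3⟩ := pos_spec s
    cases h : fibWord s
    · rw [pos_a h, cnt_b (h2 h), cnt_a h1, ih]
    · rw [pos_b h, cnt_a h1, ih]

theorem exists_pos (i : ℕ) : ∃ s, i = pos s ∨ (i = pos s + 1 ∧ fibWord s = false) := by
  induction i with
  | zero => exact ⟨0, Or.inl rfl⟩
  | succ i ih =>
    obtain ⟨s, rfl | ⟨rfl, h⟩⟩ := ih
    · cases h : fibWord s
      · exact ⟨s, Or.inr ⟨rfl, h⟩⟩
      · exact ⟨s + 1, Or.inl (pos_b h).symm⟩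
    · exact ⟨s + 1, Or.inl (pos_a h).symm⟩

theorem eq_pos {i : ℕ} (h : fibWord i = false) : i = pos (cnt i) := by
  obtain ⟨s, rfl | ⟨rfl, h'⟩⟩ := exists_pos i
  · rw [cnt_pos]
  · rw [(pos_spec s).2.1 h'] at h; cases h

theorem b_spec {i : ℕ} (h : fibWord i = true) :
    ∃ i', i = i' + 1 ∧ fibWord i' = false ∧ fibWord (i + 1) = false := by
  obtain ⟨s, rfl | ⟨rfl, h'⟩⟩ := exists_pos i
  · rw [(pos_spec s).1] at h; cases h
  · refine ⟨pos s, rfl, (pos_spec s).1, ?_⟩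
    have := (pos_spec (s + 1)).1
    rwa [pos_a h'] at this

theorem no_aaa {i : ℕ} (h0 : fibWord i = false) (h1 : fibWord (i + 1) = false) :
    fibWord (i + 2) = true := by
  have e := eq_pos h0
  set s := cnt i
  obtain ⟨g1, g2, g3⟩ := pos_spec s
  have hs : fibWord s = true := by
    cases h : fibWord s
    · rw [e, g2 h] at h1; cases h1
    · rfl
  obtain ⟨_, _, _, h4⟩ := b_spec hs
  have := (pos_spec (s + 1)).2.1 h4
  rw [pos_b hs, ← e] at this
  exact this

theorem pos_next (s : ℕ) : fibWord (pos s + 1) = !fibWord s := by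
  cases h : fibWord s
  · exact (pos_spec s).2.1 h
  · exact (pos_spec s).2.2 h

theorem pos_add_two (s : ℕ) : pos s + 3 ≤ pos (s + 2) := by
  rw [show s + 2 = s + 1 + 1 from rfl]
  cases h : fibWord s
  · have := pos_a h
    cases h' : fibWord (s + 1)
    · have := pos_a h'; omega
    · have := pos_b h'; omega
  · obtain ⟨_, _, _, h4⟩ := b_spec h
    have := pos_b h
    have := pos_a h4; omega

theorem pos_mono {s t : ℕ} (h : s ≤ t) : pos s ≤ pos t := by
  unfold pos; have := cnt_mono h; omega

/-- Every period of a (near-)square is a Fibonacci number, with the expected letter count. -/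
theorem U (p : ℕ) : 1 ≤ p → ∀ i, (∀ j, i ≤ j → j + 1 < i + p → fibWord j = fibWord (j + p)) →
    ∃ k, p = Nat.fib (k + 1) ∧ cnt (i + p) = cnt i + Nat.fib k := by
  induction p using Nat.strong_induction_on with
  | _ p ih =>
    intro hp
    -- the case where the window starts with the letter a
    have main : 2 ≤ p → ∀ i, fibWord i = false →
        (∀ j, i ≤ j → j + 1 < i + p → fibWord j = fibWord (j + p)) →
        ∃ k, p = Nat.fib (k + 1) ∧ cnt (i + p) = cnt i + Nat.fib k := by
      intro hp2 i hi hm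
      have hip : fibWord (i + p) = false := by rw [← hm i le_rfl (by omega)]; exact hi
      have e1 := eq_pos hi
      have e2 := eq_pos hip
      set s := cnt i with hs
      obtain ⟨q, hq⟩ : ∃ q, cnt (i + p) = s + q :=
        ⟨cnt (i + p) - s, by have := cnt_mono (show i ≤ i + p by omega); omega⟩
      rw [hq] at e2
      have hq1 : 1 ≤ q := by
        have h1 := cnt_a hi
        have h2 := cnt_mono (show i + 1 ≤ i + p by omega)
        omega
      have hqp : q < p := by
        have h1 := cnt_a hi
        cases h : fibWord (i + 1)
        · have h3 := no_aaa hi h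
          have h4 : p ≠ 2 := by
            rintro rfl
            rw [hip] at h3; cases h3
          have h5 : cnt (i + 3) = cnt (i + 2) := cnt_b h3
          have h6 : cnt (i + 2) = cnt (i + 1) + 1 := cnt_a h
          have h7 := cnt_le (i + 3) (p - 3)
          rw [show i + 3 + (p - 3) = i + p by omega] at h7
          omega
        · have h6 : cnt (i + 2) = cnt (i + 1) := cnt_b h
          have h7 := cnt_le (i + 2) (p - 2)
          rw [show i + 2 + (p - 2) = i + p by omega] at h7
          omega
      have hC : ∀ t, t < q → pos (s + t + q) = pos (s + t) + p ∧
          (t + 1 < q → fibWord (s + t) = fibWord (s + t + q)) := by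
        intro t
        induction t with
        | zero =>
          intro _
          have hc0 : pos (s + 0 + q) = pos (s + 0) + p := by
            simp only [add_zero]; omega
          refine ⟨hc0, ?_⟩
          intro ht
          have h2 := pos_add_two s
          have h3 := pos_mono (show s + 2 ≤ s + q by omega)
          have h4 := hm (pos s + 1) (by omega) (by omega)
          rw [show pos s + 1 + p = pos (s + q) + 1 by omega] at h4
          rw [pos_next, pos_next] at h4
          simp only [add_zero]
          exact Bool.not_inj h4
        | succ t iht =>
          intro ht
          obtain ⟨c1, c2⟩ := iht (by omega)
          have c3 := c2 ht
          have hc0 : pos (s + (t + 1) + q) = pos (s + (t + 1)) + p := by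
            rw [show s + (t + 1) + q = s + t + q + 1 by omega, ← add_assoc]
            cases h : fibWord (s + t)
            · rw [pos_a h, pos_a (by rw [← c3]; exact h)]; omega
            · rw [pos_b h, pos_b (by rw [← c3]; exact h)]; omega
          refine ⟨hc0, ?_⟩
          intro ht
          have h1 := pos_mono (show s ≤ s + (t + 1) by omega)
          have h2 := pos_add_two (s + (t + 1))
          have h3 := pos_mono (show s + (t + 1) + 2 ≤ s + q by omega)
          have h4 := hm (pos (s + (t + 1)) + 1) (by omega) (by omega)
          rw [show pos (s + (t + 1)) + 1 + p = pos (s + (t + 1) + q) + 1 by omega] at h4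
          rw [pos_next, pos_next] at h4
          exact Bool.not_inj h4
      obtain ⟨k, hk1, hk2⟩ := ih q hqp hq1 s (by
        intro j hj1 hj2
        have := (hC (j - s) (by omega)).2 (by omega)
        rwa [show s + (j - s) = j by omega] at this)
      refine ⟨k + 1, ?_, by rw [hq, hk1]⟩
      have h9 : p = q + (cnt (s + q) - cnt s) := by
        unfold pos at e1 e2; omega
      rw [h9, hk2, fib3 k, hk1]; omega
    intro i hm
    by_cases hp2 : 2 ≤ p
    · cases h : fibWord i
      · exact main hp2 i h hm
      · obtain ⟨i', rfl, h1, _⟩ := b_spec h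
        have h2 : fibWord (i' + p + 1) = true := by
          rw [show i' + p + 1 = i' + 1 + p by omega, ← hm (i' + 1) le_rfl (by omega)]; exact h
        obtain ⟨x, hx1, hx2, _⟩ := b_spec h2
        obtain rfl : x = i' + p := by omega
        obtain ⟨k, hk1, hk2⟩ := main hp2 i' h1 (by
          intro j hj1 hj2
          by_cases hj : j = i'
          · subst hj; rw [h1, hx2]
          · exact hm j (by omega) (by omega))
        refine ⟨k, hk1, ?_⟩
        rw [show i' + 1 + p = i' + p + 1 by omega, cnt_a hx2, cnt_a h1, hk2]; omega
    · obtain rfl : p = 1 := by omega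
      cases h : fibWord i
      · exact ⟨1, rfl, by rw [cnt_a h]; rfl⟩
      · exact ⟨0, rfl, by rw [cnt_b h]; rfl⟩

/-- a square of period `p` starts at (0-indexed) position `i` -/
def Sq (p i : ℕ) : Prop := ∀ t, t < p → fibWord (i + t) = fibWord (i + p + t)

theorem sum_periodic (v : ℕ → ℕ) (q : ℕ) (hv : ∀ m, v (m + q) = v m) (r : ℕ) :
    ∑ m ∈ Finset.range (r * q), v m = r * ∑ m ∈ Finset.range q, v m := by
  have hr : ∀ r m, v (r * q + m) = v m := by
    intro r m
    induction r with
    | zero => simp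
    | succ r ih => rw [show (r + 1) * q + m = (r * q + m) + q by ring, hv, ih]
  induction r with
  | zero => simp
  | succ r ih =>
    rw [add_mul, one_mul, Finset.sum_range_add, ih, add_mul, one_mul]
    congr 1
    exact Finset.sum_congr rfl fun m _ => hr r m

theorem cnt_sum (i p : ℕ) :
    cnt (i + p) = cnt i + ∑ m ∈ Finset.range p, (if fibWord (i + m) = false then 1 else 0) := by
  induction p with
  | zero => simp
  | succ p ih => rw [← add_assoc, cnt, ih, Finset.sum_range_succ]; omega

theorem prim {p i d : ℕ} (hsq : Sq p i) (hd : 0 < d) (hdp : d < p)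
    (hm : ∀ t, t < p → fibWord (i + t) = fibWord (i + d + t)) : False := by
  obtain ⟨k, hk1, hk2⟩ := U p (by omega) i (by
    intro j hj1 hj2
    have := hsq (j - i) (by omega)
    rwa [show i + (j - i) = j by omega, show i + p + (j - i) = j + p by omega] at this)
  have hA := cnt_sum i p
  set v : ℕ → ℕ := fun m => if fibWord (i + m % p) = false then 1 else 0 with hv
  have hsum : ∑ m ∈ Finset.range p, v m = Nat.fib k := by
    rw [show Nat.fib k = ∑ m ∈ Finset.range p, (if fibWord (i + m) = false then 1 else 0) by omega]
    refine Finset.sum_congr rfl fun m hm => ?_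
    simp only [hv]; rw [Nat.mod_eq_of_lt (Finset.mem_range.1 hm)]
  have h1 := sum_periodic v p (by intro m; simp [hv]) d
  have h2 := sum_periodic v d (by
    intro m
    have hlt : m % p < p := Nat.mod_lt _ (by omega)
    have h3 := hm (m % p) hlt
    have h4 : fibWord (i + (m + d) % p) = fibWord (i + d + m % p) := by
      rw [Nat.add_mod, Nat.mod_eq_of_lt hdp]
      by_cases hc : m % p + d < p
      · rw [Nat.mod_eq_of_lt hc]; congr 1; omega
      · have h5 := hsq (m % p + d - p) (by omega)
        rw [Nat.mod_eq_sub_mod (by omega), Nat.mod_eq_of_lt (by omega), h5]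
        congr 1; omega
    simp only [hv]; rw [h4, ← h3]) p
  rw [mul_comm p d, h1, hsum] at h2
  have h6 : p ∣ d * Nat.fib k := ⟨_, h2⟩
  have h7 : Nat.Coprime p (Nat.fib k) := by
    rw [hk1]; exact (Nat.fib_coprime_fib_succ k).symm
  have h8 := Nat.le_of_dvd hd (h7.dvd_of_dvd_mul_right h6)
  omega

/-- the start positions of first occurrences of squares of period `fib (k+2)` -/
def Valid (k i : ℕ) : Prop := i + 2 ≤ Nat.fib (k + 1) ∨
  (Nat.fib (k + 3) + Nat.fib (k + 1) ≤ i + 1 ∧ i + 1 ≤ Nat.fib (k + 4))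

def Same (p i i' : ℕ) : Prop := ∀ t, t < p → fibWord (i + t) = fibWord (i' + t)

theorem sq_first (k i : ℕ) (h : i + 2 ≤ Nat.fib (k + 1)) : Sq (Nat.fib (k + 2)) i := by
  intro t ht
  have e := fib3 (k + 1)
  rw [show i + Nat.fib (k + 2) + t = i + t + Nat.fib (k + 2) by omega, M1 k]
  have : Nat.fib (k + 1 + 2) = Nat.fib (k + 3) := rfl
  have : Nat.fib (k + 1 + 1) = Nat.fib (k + 2) := rfl
  omega

theorem key (k i : ℕ) : (Sq (Nat.fib (k + 2)) i ∧
    ∀ i', i' < i → ¬ (Sq (Nat.fib (k + 2)) i' ∧ Same (Nat.fib (k + 2)) i' i)) ↔ Valid k i := by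
  have e3 : Nat.fib (k + 3) = Nat.fib (k + 1) + Nat.fib (k + 2) := fib3 (k + 1)
  have e4 : Nat.fib (k + 4) = Nat.fib (k + 2) + Nat.fib (k + 3) := fib3 (k + 2)
  have e5 : Nat.fib (k + 5) = Nat.fib (k + 3) + Nat.fib (k + 4) := fib3 (k + 3)
  have p1 : 0 < Nat.fib (k + 1) := Nat.fib_pos.2 (by omega)
  have p2 : 0 < Nat.fib (k + 2) := Nat.fib_pos.2 (by omega)
  have p3 : Nat.fib (k + 1) ≤ Nat.fib (k + 2) := Nat.fib_mono (by omega)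
  have m0 : ∀ j, j < Nat.fib (k + 3) → (fibWord (j + Nat.fib (k + 2)) = fibWord j ↔
    j + 2 < Nat.fib (k + 3)) := MM k
  have m1 : ∀ j, j + 2 < Nat.fib (k + 4) → fibWord (j + Nat.fib (k + 3)) = fibWord j := M1 (k + 1)
  have m2 : ∀ j, j + 2 < Nat.fib (k + 5) → fibWord (j + Nat.fib (k + 4)) = fibWord j := M1 (k + 2)
  -- squares avoid the first mismatch
  have avoid : ∀ i, Sq (Nat.fib (k + 2)) i → i + 2 ≤ Nat.fib (k + 1) ∨ Nat.fib (k + 3) ≤ i := by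
    intro i hsq
    by_contra hcon
    push Not at hcon
    -- the mismatch at max i (f-2)
    obtain ⟨j, hj1, hj2, hj3, hj4⟩ : ∃ j, i ≤ j ∧ j < i + Nat.fib (k + 2) ∧ j < Nat.fib (k + 3) ∧
        Nat.fib (k + 3) ≤ j + 2 := by
      by_cases hh : i + 2 ≤ Nat.fib (k + 3)
      · exact ⟨Nat.fib (k + 3) - 2, by omega, by omega, by omega, by omega⟩
      · exact ⟨i, le_rfl, by omega, by omega, by omega⟩
    have h1 := hsq (j - i) (by omega)
    rw [show i + (j - i) = j by omega,
      show i + Nat.fib (k + 2) + (j - i) = j + Nat.fib (k + 2) by omega] at h1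
    have := (m0 j hj3).1 h1.symm
    omega
  constructor
  · rintro ⟨hsq, hno⟩
    by_contra hv
    unfold Valid at hv
    push Not at hv
    obtain ⟨hv1, hv2⟩ := hv
    have hge : Nat.fib (k + 3) ≤ i := by
      rcases avoid i hsq with h | h <;> omega
    by_cases hc : i + 1 < Nat.fib (k + 3) + Nat.fib (k + 1)
    · apply hno (i - Nat.fib (k + 3)) (by omega)
      refine ⟨sq_first k _ (by omega), ?_⟩
      intro t ht
      rw [← m1 _ (by omega)]; congr 1; omega
    · have h4 : Nat.fib (k + 2 + 2) ≤ i := by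
        have : Nat.fib (k + 2 + 2) = Nat.fib (k + 4) := rfl
        omega
      obtain ⟨m, hm0, hm1, hm2⟩ := exists_fib i (k + 2) h4
      have e6 := fib3 (m + 1)
      have e6' : Nat.fib (m + 1 + 2) = Nat.fib (m + 3) := rfl
      have e6'' : Nat.fib (m + 1 + 1) = Nat.fib (m + 2) := rfl
      have e7 : Nat.fib (k + 4) ≤ Nat.fib (m + 2) := Nat.fib_mono (by omega)
      have hsame : ∀ t, t < 2 * Nat.fib (k + 2) →
          fibWord (i - Nat.fib (m + 2) + t) = fibWord (i + t) := by
        intro t ht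
        rw [← M1 m _ (by omega)]; congr 1; omega
      apply hno (i - Nat.fib (m + 2)) (by omega)
      refine ⟨?_, fun t ht => hsame t (by omega)⟩
      intro t ht
      rw [hsame t (by omega), hsq t ht, add_assoc, add_assoc, hsame _ (by omega)]
  · -- general obstruction to repeated occurrences at small distance
    have obstr : ∀ i' i, i' < i → i < i' + Nat.fib (k + 2) → Sq (Nat.fib (k + 2)) i' →
        Same (Nat.fib (k + 2)) i' i → False := by
      intro i' i h1 h2 h3 h4
      refine prim h3 (d := i - i') (by omega) (by omega) ?_
      intro t ht
      rw [show i' + (i - i') + t = i + t by omega]; exact h4 t ht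
    rintro (h | ⟨h1, h2⟩)
    · refine ⟨sq_first k i h, ?_⟩
      rintro i' hi ⟨h3, h4⟩
      exact obstr i' i hi (by omega) h3 h4
    · have big : ∀ i, Nat.fib (k + 3) ≤ i → i + 1 ≤ Nat.fib (k + 4) → Sq (Nat.fib (k + 2)) i := by
        intro i h1 h2 t ht
        have g1 := m1 (i - Nat.fib (k + 3) + t) (by omega)
        have g2 := m2 (i - Nat.fib (k + 3) + t) (by omega)
        rw [show i - Nat.fib (k + 3) + t + Nat.fib (k + 3) = i + t by omega] at g1
        rw [show i - Nat.fib (k + 3) + t + Nat.fib (k + 4) = i + Nat.fib (k + 2) + t by omega] at g2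
        rw [g1, g2]
      refine ⟨big i (by omega) h2, ?_⟩
      rintro i' hi ⟨h3, h4⟩
      rcases avoid i' h3 with h5 | h5
      · refine obstr (i' + Nat.fib (k + 3)) i (by omega) (by omega) (big _ (by omega) (by omega)) ?_
        intro t ht
        rw [← h4 t ht, ← m1 (i' + t) (by omega)]; congr 1; omega
      · exact obstr i' i hi (by omega) h3 h4

/-- factor of length `p` starting at 0-indexed position `i` -/
def fac (i p : ℕ) : List Bool := (List.range p).map fun t => fibWord (i + t)

theorem fac_length (i p : ℕ) : (fac i p).length = p := by simp [fac]

theorem fac_add (i p q : ℕ) : fac i (p + q) = fac i p ++ fac (i + p) q := by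
  simp [fac, List.range_add, add_assoc]

theorem fac_eq {i i' p : ℕ} : fac i p = fac i' p ↔ Same p i i' := by
  simp [fac, Same]

def S (n : ℕ) : Set (List Bool) := {w | ∃ i p, 1 ≤ p ∧ i + 2 * p ≤ n ∧ Sq p i ∧ w = fac i p}

theorem D2_set (n : ℕ) : {w : List Bool | w ≠ [] ∧ (w ++ w) <:+: fFactor 1 n} = S n := by
  have e : fFactor 1 n = fac 0 n := by simp [fFactor, fac]
  rw [e]
  ext w
  constructor
  · rintro ⟨hw, s, t, hst⟩
    have hl := congrArg List.length hst
    simp only [List.length_append, fac_length] at hl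
    have hpos : 0 < w.length := List.length_pos_iff.2 hw
    rw [show n = (s.length + (w.length + w.length)) + t.length by omega, fac_add, fac_add,
      fac_add] at hst
    have h1 := List.append_inj hst (by simp [fac_length])
    have h2 := List.append_inj h1.1 (by simp [fac_length])
    have h3 := List.append_inj h2.2 (by simp [fac_length])
    simp only [zero_add] at h3
    refine ⟨s.length, w.length, hpos, by omega, ?_, h3.1⟩
    exact fac_eq.1 (h3.1.symm.trans h3.2)
  · rintro ⟨i, p, hp, hi, hsq, rfl⟩
    constructor
    · intro h
      have := congrArg List.length h
      rw [fac_length] at this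
      simp at this; omega
    · refine ⟨fac 0 i, fac (i + (p + p)) (n - (i + (p + p))), ?_⟩
      have h1 : fac i p = fac (i + p) p := fac_eq.2 hsq
      conv_rhs => rw [show n = (i + (p + p)) + (n - (i + (p + p))) by omega, fac_add, fac_add,
        fac_add]
      simp only [zero_add]
      rw [← h1]

/-- `e` is the end of the first occurrence of a square of period `fib (k+2)`. -/
theorem new_iff (n : ℕ) (w : List Bool) : (w ∈ S (n + 1) ∧ w ∉ S n) ↔
    ∃ k i, Valid k i ∧ i + 2 * Nat.fib (k + 2) = n + 1 ∧ w = fac i (Nat.fib (k + 2)) := by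
  constructor
  · rintro ⟨⟨i, p, hp, hi, hsq, rfl⟩, hn⟩
    obtain ⟨k, rfl⟩ : ∃ k, p = Nat.fib (k + 2) := by
      obtain ⟨k, hk, _⟩ := U p hp i (by
        intro j hj1 hj2
        have := hsq (j - i) (by omega)
        rwa [show i + (j - i) = j by omega, show i + p + (j - i) = j + p by omega] at this)
      cases k with
      | zero => exact ⟨0, hk⟩
      | succ k => exact ⟨k, hk⟩
    have hie : i + 2 * Nat.fib (k + 2) = n + 1 := by
      by_contra hne
      exact hn ⟨i, _, hp, by omega, hsq, rfl⟩
    refine ⟨k, i, (key k i).1 ⟨hsq, ?_⟩, hie, rfl⟩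
    rintro i' hi' ⟨h1, h2⟩
    exact hn ⟨i', _, hp, by omega, h1, (fac_eq.2 h2).symm⟩
  · rintro ⟨k, i, hv, hie, rfl⟩
    obtain ⟨h1, h2⟩ := (key k i).2 hv
    have p2 : 0 < Nat.fib (k + 2) := Nat.fib_pos.2 (by omega)
    refine ⟨⟨i, _, p2, by omega, h1, rfl⟩, ?_⟩
    rintro ⟨i', p', _, g2, g3, g4⟩
    have := congrArg List.length g4
    rw [fac_length, fac_length] at this
    subst this
    exact h2 i' (by omega) ⟨g3, (fac_eq.1 g4.symm)⟩

theorem S_mono (n : ℕ) : S n ⊆ S (n + 1) := by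
  rintro w ⟨i, p, hp, hi, h⟩
  exact ⟨i, p, hp, by omega, h⟩

/-- uniqueness of the level -/
theorem level_unique {n h h' : ℕ} (h1 : 2 * Nat.fib (h + 2) ≤ n) (h2 : n < 2 * Nat.fib (h + 3))
    (h1' : 2 * Nat.fib (h' + 2) ≤ n) (h2' : n < 2 * Nat.fib (h' + 3)) : h = h' := by
  rcases lt_trichotomy h h' with hh | hh | hh
  · have : Nat.fib (h + 3) ≤ Nat.fib (h' + 2) := Nat.fib_mono (by omega)
    omega
  · exact hh
  · have : Nat.fib (h' + 3) ≤ Nat.fib (h + 2) := Nat.fib_mono (by omega)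
    omega

/-- the level of a valid end -/
theorem valid_level {k i n : ℕ} (hv : Valid k i) (hie : i + 2 * Nat.fib (k + 2) = n) :
    (2 * Nat.fib (k + 2) ≤ n ∧ n < 2 * Nat.fib (k + 3) ∧ n + 2 ≤ Nat.fib (k + 4)) ∨
    (2 * Nat.fib (k + 3) ≤ n ∧ n < 2 * Nat.fib (k + 4) ∧ Nat.fib (k + 5) ≤ n + 1 ∧
      n + 1 ≤ Nat.fib (k + 5) + Nat.fib k) := by
  have e2 : Nat.fib (k + 2) = Nat.fib k + Nat.fib (k + 1) := fib3 k
  have e3 : Nat.fib (k + 3) = Nat.fib (k + 1) + Nat.fib (k + 2) := fib3 (k + 1)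
  have e4 : Nat.fib (k + 4) = Nat.fib (k + 2) + Nat.fib (k + 3) := fib3 (k + 2)
  have e5 : Nat.fib (k + 5) = Nat.fib (k + 3) + Nat.fib (k + 4) := fib3 (k + 3)
  have p1 : 0 < Nat.fib (k + 1) := Nat.fib_pos.2 (by omega)
  rcases hv with h | ⟨h, h'⟩
  · left; omega
  · right; omega

/-- first occurrences at level `h+1` -/
theorem step_card (n h : ℕ) (h1 : 2 * Nat.fib (h + 3) ≤ n + 1) (h2 : n + 1 < 2 * Nat.fib (h + 4))
    (hfin : (S n).Finite) :
    (S (n + 1)).Finite ∧ (S (n + 1)).ncard =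
      (S n).ncard + if n + 2 ≤ Nat.fib (h + 5) + Nat.fib h then 1 else 0 := by
  have e2 : Nat.fib (h + 2) = Nat.fib h + Nat.fib (h + 1) := fib3 h
  have e3 : Nat.fib (h + 3) = Nat.fib (h + 1) + Nat.fib (h + 2) := fib3 (h + 1)
  have e4 : Nat.fib (h + 4) = Nat.fib (h + 2) + Nat.fib (h + 3) := fib3 (h + 2)
  have e5 : Nat.fib (h + 5) = Nat.fib (h + 3) + Nat.fib (h + 4) := fib3 (h + 3)
  by_cases hc : n + 2 ≤ Nat.fib (h + 5) + Nat.fib h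
  · rw [if_pos hc]
    have hw : ∃ w, (w ∈ S (n + 1) ∧ w ∉ S n) ∧ ∀ w', w' ∈ S (n + 1) ∧ w' ∉ S n → w' = w := by
      by_cases hc2 : n + 3 ≤ Nat.fib (h + 5)
      · refine ⟨fac (n + 1 - 2 * Nat.fib (h + 3)) (Nat.fib (h + 3)), (new_iff n _).2
          ⟨h + 1, n + 1 - 2 * Nat.fib (h + 3), Or.inl ?_, ?_, rfl⟩, ?_⟩
        · rw [show h + 1 + 1 = h + 2 from rfl]; omega
        · rw [show h + 1 + 2 = h + 3 from rfl]; omega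
        · intro w' hw'
          obtain ⟨k, i, hv, hie, rfl⟩ := (new_iff n _).1 hw'
          rcases valid_level hv hie with ⟨g1, g2, g3⟩ | ⟨g1, g2, g3, g4⟩
          · obtain rfl := level_unique (h := h + 1) h1 h2 g1 g2
            rw [show h + 1 + 2 = h + 3 from rfl] at *
            congr 1; omega
          · have := level_unique (h := h + 1) (h' := k + 1) h1 h2 g1 g2
            obtain rfl : h = k := by omega
            omega
      · refine ⟨fac (n + 1 - 2 * Nat.fib (h + 2)) (Nat.fib (h + 2)), (new_iff n _).2
          ⟨h, n + 1 - 2 * Nat.fib (h + 2), Or.inr ?_, ?_, rfl⟩, ?_⟩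
        · omega
        · omega
        · intro w' hw'
          obtain ⟨k, i, hv, hie, rfl⟩ := (new_iff n _).1 hw'
          rcases valid_level hv hie with ⟨g1, g2, g3⟩ | ⟨g1, g2, g3, g4⟩
          · obtain rfl := level_unique (h := h + 1) h1 h2 g1 g2
            rw [show h + 1 + 4 = h + 5 from rfl] at *
            omega
          · have := level_unique (h := h + 1) (h' := k + 1) h1 h2 g1 g2
            obtain rfl : h = k := by omega
            congr 1; omega
    obtain ⟨w, ⟨hw1, hw2⟩, hw3⟩ := hw
    have hins : S (n + 1) = insert w (S n) := by
      ext x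
      constructor
      · intro hx
        by_cases hxn : x ∈ S n
        · exact Or.inr hxn
        · exact Or.inl (hw3 x ⟨hx, hxn⟩)
      · rintro (rfl | hx)
        · exact hw1
        · exact S_mono n hx
    rw [hins]
    exact ⟨hfin.insert w, Set.ncard_insert_of_notMem hw2 hfin⟩
  · rw [if_neg hc]
    have heq : S (n + 1) = S n := by
      apply Set.Subset.antisymm _ (S_mono n)
      intro x hx
      by_contra hxn
      obtain ⟨k, i, hv, hie, rfl⟩ := (new_iff n _).1 ⟨hx, hxn⟩
      rcases valid_level hv hie with ⟨g1, g2, g3⟩ | ⟨g1, g2, g3, g4⟩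
      · obtain rfl := level_unique (h := h + 1) h1 h2 g1 g2
        rw [show h + 1 + 4 = h + 5 from rfl] at *
        omega
      · have := level_unique (h := h + 1) (h' := k + 1) h1 h2 g1 g2
        obtain rfl : h = k := by omega
        omega
    rw [heq]
    exact ⟨hfin, rfl⟩

theorem S_three : S 3 = ∅ := by
  ext w
  simp only [Set.mem_empty_iff_false, iff_false]
  rintro ⟨i, p, hp, hi, hsq, rfl⟩
  obtain rfl : p = 1 := by omega
  have h := hsq 0 (by omega)
  have : i = 0 ∨ i = 1 := by omega
  rcases this with rfl | rfl
  · revert h; decide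
  · revert h; decide

theorem card_S (n : ℕ) (hn : 3 ≤ n) : (S n).Finite ∧ ∀ h, 2 * Nat.fib (h + 2) ≤ n →
    n < 2 * Nat.fib (h + 3) → ((S n).ncard : ℤ) =
      min ((n : ℤ) - (Nat.fib (h + 1) : ℤ) - 2)
        ((Nat.fib (h + 3) : ℤ) + (Nat.fib (h + 1) : ℤ) - 3) := by
  induction n, hn using Nat.le_induction with
  | base =>
    rw [S_three]
    refine ⟨Set.finite_empty, ?_⟩
    intro h h1 h2
    have : 0 = h := level_unique (n := 3) (by decide) (by decide) h1 h2
    subst this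
    simp
    decide
  | succ n hn ih =>
    obtain ⟨hfin, ih⟩ := ih
    obtain ⟨h, h1, h2⟩ : ∃ h, 2 * Nat.fib (h + 3) ≤ n + 1 ∧ n + 1 < 2 * Nat.fib (h + 4) := by
      obtain ⟨k, hk, hk1, hk2⟩ := exists_fib ((n + 1) / 2) 1
        (by have : Nat.fib (1 + 2) = 2 := rfl; omega)
      obtain ⟨k, rfl⟩ : ∃ k', k = k' + 1 := ⟨k - 1, by omega⟩
      have a1 : Nat.fib (k + 1 + 2) = Nat.fib (k + 3) := rfl
      have a2 : Nat.fib (k + 1 + 3) = Nat.fib (k + 4) := rfl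
      exact ⟨k, by omega, by omega⟩
    obtain ⟨hf, hcard⟩ := step_card n h h1 h2 hfin
    refine ⟨hf, ?_⟩
    intro h' h1' h2'
    obtain rfl := level_unique (h := h + 1) h1 h2 h1' h2'
    have e2 : Nat.fib (h + 2) = Nat.fib h + Nat.fib (h + 1) := fib3 h
    have e3 : Nat.fib (h + 3) = Nat.fib (h + 1) + Nat.fib (h + 2) := fib3 (h + 1)
    have e4 : Nat.fib (h + 4) = Nat.fib (h + 2) + Nat.fib (h + 3) := fib3 (h + 2)
    have e5 : Nat.fib (h + 5) = Nat.fib (h + 3) + Nat.fib (h + 4) := fib3 (h + 3)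
    have a1 : Nat.fib (h + 1 + 1) = Nat.fib (h + 2) := rfl
    have a2 : Nat.fib (h + 1 + 3) = Nat.fib (h + 4) := rfl
    have p1 : 0 < Nat.fib (h + 1) := Nat.fib_pos.2 (by omega)
    rw [hcard, a1, a2]
    by_cases hc : 2 * Nat.fib (h + 3) ≤ n
    · have := ih (h + 1) hc (by rw [a2]; omega)
      rw [a1, a2] at this
      split_ifs with hs <;> push_cast <;> omega
    · have := ih h (by omega) (by omega)
      split_ifs with hs <;> push_cast <;> omega

end FibSq

/-- The number of distinct squares in the prefix `F[1,n]` equals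
`min (n - f_{h-1} - 2) (f_{h+1} + f_{h-1} - 3)` where `2f_h ≤ n < 2f_{h+1}`. -/
theorem number_of_squares_in_prefix (n h : ℕ) (hn : 3 ≤ n)
    (h1 : 2 * fn h ≤ n) (h2 : n < 2 * fn (h + 1)) :
    (D2 1 n : ℤ) =
      min ((n : ℤ) - (Nat.fib (h + 1) : ℤ) - 2)
        ((fn (h + 1) : ℤ) + (Nat.fib (h + 1) : ℤ) - 3) := by
  unfold D2
  rw [FibSq.D2_set]
  exact (FibSq.card_S n hn).2 h h1 h2
end

section
/- For every integer n ≥ 9, letting h ≥ 2 be the unique integer with 2f_h ≤ n < 2f_{h+1}, the number of distinct (2+ε)-powers occurring as factors of the prefix F[1,n] of the Fibonacci word equals min{n − f_{h−1} − 6, f_{h+1} + f_{h−1} − 6}. -/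
/-- `D2e i n`: the number of distinct (2+ε)-powers `w·w·c` (with `c` the first
letter of `w`) occurring as factors of `F[i;n]`. -/
noncomputable def D2e (i n : ℕ) : ℕ :=
  {w : List Bool | w ≠ [] ∧ (w ++ w ++ [w.headI]) <:+: fFactor i n}.ncard


/-! ### The morphism and desubstitution -/

/-- The Fibonacci morphism on lists. -/
def sg : List Bool → List Bool
  | [] => []
  | true :: z => false :: sg z
  | false :: z => false :: true :: sg z

theorem sg_append (x y : List Bool) : sg (x ++ y) = sg x ++ sg y := by
  induction x with
  | nil => rfl
  | cons c x ih => cases c <;> simp [sg, ih]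

theorem sg_Fw (k : ℕ) : sg (Fw k) = Fw (k + 1) := by
  induction k using Nat.strong_induction_on with
  | _ k ih =>
    match k with
    | 0 => rfl
    | 1 => rfl
    | k + 2 =>
      rw [Fw, sg_append, ih (k + 1) (by omega), ih k (by omega)]
      rfl

theorem sg_ne_true (z q : List Bool) : sg z ≠ true :: q := by
  rcases z with _ | ⟨_ | _, z⟩ <;> simp [sg]

theorem sg_inj {x y : List Bool} (h : sg x = sg y) : x = y := by
  induction x generalizing y with
  | nil => rcases y with _ | ⟨_ | _, y⟩ <;> simp_all [sg]
  | cons c x ih =>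
    rcases c with _ | _ <;> rcases y with _ | ⟨_ | _, y⟩ <;> simp [sg] at h ⊢
    · exact ih h
    · exact sg_ne_true _ _ h.symm
    · exact sg_ne_true _ _ h
    · exact ih h

theorem sg_nil {x : List Bool} (h : sg x = []) : x = [] := sg_inj (y := []) h

/-- Cutting before a letter `a`. -/
theorem sg_cut {z p q : List Bool} (h : sg z = p ++ false :: q) :
    ∃ z1 z2, z = z1 ++ z2 ∧ sg z1 = p ∧ sg z2 = false :: q := by
  induction z generalizing p with
  | nil => simp [sg] at h
  | cons c z ih =>
    rcases p with _ | ⟨d, p⟩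
    · exact ⟨[], c :: z, rfl, rfl, h⟩
    · rcases c with _ | _
      · rcases p with _ | ⟨e, p⟩
        · simp [sg] at h
        · simp [sg] at h
          obtain ⟨z1, z2, rfl, h1, h2⟩ := ih h.2.2
          exact ⟨false :: z1, z2, rfl, by simp [sg, h1, h.1, h.2.1], h2⟩
      · simp [sg] at h
        obtain ⟨z1, z2, rfl, h1, h2⟩ := ih h.2
        exact ⟨true :: z1, z2, rfl, by simp [sg, h1, h.1], h2⟩

/-- Every `b` is preceded by an `a`. -/
theorem sg_bpre {z p q : List Bool} (h : sg z = p ++ true :: q) :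
    ∃ p', p = p' ++ [false] := by
  induction z generalizing p with
  | nil => simp [sg] at h
  | cons c z ih =>
    rcases p with _ | ⟨d, p⟩
    · exact absurd h (sg_ne_true _ _)
    · rcases c with _ | _
      · rcases p with _ | ⟨e, p⟩
        · simp [sg] at h
          exact ⟨[], by simp [h.1]⟩
        · simp [sg] at h
          obtain ⟨p', rfl⟩ := ih h.2.2
          exact ⟨d :: e :: p', rfl⟩
      · simp [sg] at h
        obtain ⟨p', rfl⟩ := ih h.2
        exact ⟨d :: p', rfl⟩

/-- a leading `ab` comes from a leading `a`. -/
theorem sg_ab {z q : List Bool} (h : sg z = false :: true :: q) :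
    ∃ z', z = false :: z' := by
  rcases z with _ | ⟨_ | _, z⟩
  · simp [sg] at h
  · exact ⟨z, rfl⟩
  · simp [sg] at h
    exact absurd h (sg_ne_true _ _)

/-- a leading `aa` comes from a leading `b`. -/
theorem sg_aa {z q : List Bool} (h : sg z = false :: false :: q) :
    ∃ z', z = true :: z' := by
  rcases z with _ | ⟨_ | _, z⟩
  · simp [sg] at h
  · simp [sg] at h
  · exact ⟨z, rfl⟩

theorem sg_eq_ab {z : List Bool} (h : sg z = [false, true]) : z = [false] :=
  sg_inj (y := [false]) h

theorem sg_eq_a {z : List Bool} (h : sg z = [false]) : z = [true] :=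
  sg_inj (y := [true]) h

/-! ### Factors -/

theorem Fw_no_bb (k : ℕ) (x y : List Bool) : Fw k ≠ x ++ true :: true :: y := by
  intro h
  rcases k with _ | k
  · have := congrArg List.length h
    simp [Fw] at this
    omega
  · rw [← sg_Fw] at h
    obtain ⟨p, hp⟩ := sg_bpre (p := x ++ [true]) (q := y) (by simpa using h)
    have := congrArg List.getLast? hp
    simp at this

theorem Fw_no_aaa (k : ℕ) (x y : List Bool) :
    Fw k ≠ x ++ false :: false :: false :: y := by
  intro h
  rcases k with _ | k
  · have := congrArg List.length h
    simp [Fw] at this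
    omega
  · rw [← sg_Fw] at h
    obtain ⟨z1, z2, hz, h1, h2⟩ := sg_cut h
    obtain ⟨z3, rfl⟩ := sg_aa h2
    simp [sg] at h2
    obtain ⟨z4, rfl⟩ := sg_aa h2
    exact Fw_no_bb _ _ _ hz

theorem Fw_no_babab (k : ℕ) (x y : List Bool) :
    Fw k ≠ x ++ true :: false :: true :: false :: true :: y := by
  intro h
  rcases k with _ | k
  · have := congrArg List.length h
    simp [Fw] at this
    omega
  · rw [← sg_Fw] at h
    obtain ⟨x', rfl⟩ := sg_bpre h
    rw [List.append_assoc] at h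
    obtain ⟨z1, z2, hz, h1, h2⟩ := sg_cut h
    obtain ⟨z3, rfl⟩ := sg_ab h2
    simp [sg] at h2
    obtain ⟨z4, rfl⟩ := sg_ab h2
    simp [sg] at h2
    obtain ⟨z5, rfl⟩ := sg_ab h2
    exact Fw_no_aaa _ _ _ hz

theorem append_singleton_cons {α : Type*} (u : List α) (c d : α) (w : List α)
    (h : u ++ [c] = d :: w) : u = [] ∨ ∃ u', u = d :: u' := by
  rcases u with _ | ⟨e, u⟩
  · exact Or.inl rfl
  · simp at h
    exact Or.inr ⟨u, by rw [h.1]⟩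

theorem last_contra {p p' : List Bool} (h : p ++ [true] = p' ++ [false]) : False := by
  have := congrArg List.getLast? h
  simp at this

/-- `b x a x b` forces `x` empty. -/
theorem Fw_bxaxb (k : ℕ) (x p q : List Bool)
    (h : Fw k = p ++ [true] ++ x ++ [false] ++ x ++ [true] ++ q) : x = [] := by
  rcases k with _ | k
  · have := congrArg List.length h
    simp [Fw] at this
    omega
  rw [← sg_Fw] at h
  by_contra hx
  obtain ⟨c, x1, rfl⟩ := List.exists_cons_of_ne_nil hx
  rcases c with _ | _
  swap
  · obtain ⟨p', hp⟩ := sg_bpre (p := p ++ [true])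
      (q := x1 ++ [false] ++ true :: x1 ++ [true] ++ q) (by simpa using h)
    exact last_contra hp
  · obtain ⟨p', hp⟩ := sg_bpre (p := p ++ [true] ++ false :: x1 ++ [false] ++ false :: x1)
      (q := q) (by simpa using h)
    obtain ⟨x2, hx2⟩ : ∃ x2, false :: x1 = x2 ++ [false] := by
      rcases List.eq_nil_or_concat x1 with rfl | ⟨x2, d, rfl⟩
      · exact ⟨[], rfl⟩
      · rcases d with _ | _
        · exact ⟨false :: x2, by simp⟩
        · exfalso
          apply last_contra (p := p ++ [true] ++ false :: (x2 ++ [true]) ++ [false] ++ false :: x2) (p' := p')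
          rw [← hp]; simp
    rw [hx2] at h
    obtain ⟨z1, z2, hz, h1, h2⟩ := sg_cut (z := Fw k) (p := p ++ [true] ++ x2)
      (q := false :: (x2 ++ [false] ++ [true] ++ q)) (by simpa using h)
    obtain ⟨z3, rfl⟩ := sg_aa h2
    simp [sg] at h2
    rcases append_singleton_cons _ _ _ _ hx2.symm with rfl | ⟨x3, rfl⟩
    · -- first letters: x = [a], so factor is `b a a a b`
      simp at h
      exact Fw_no_aaa (k + 1) (p ++ [true]) (true :: q) (by rw [← sg_Fw, h]; simp)
    · obtain ⟨z4, rfl⟩ := sg_aa (q := x3 ++ false :: true :: q) (by simpa using h2)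
      exact Fw_no_bb _ _ _ hz

/-- `a u b u a` forces `u = ε` or `u = a`. -/
theorem Fw_aubua (k : ℕ) (u p q : List Bool)
    (h : Fw k = p ++ [false] ++ u ++ [true] ++ u ++ [false] ++ q) :
    u = [] ∨ u = [false] := by
  rcases k with _ | k
  · have := congrArg List.length h
    simp [Fw] at this
    omega
  rw [← sg_Fw] at h
  by_cases hu : u = []
  · exact Or.inl hu
  right
  obtain ⟨c, u1, rfl⟩ := List.exists_cons_of_ne_nil hu
  rcases c with _ | _
  swap
  · obtain ⟨p', hp⟩ := sg_bpre (p := p ++ [false] ++ true :: u1 ++ [true])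
      (q := u1 ++ [false] ++ q) (by simpa using h)
    exact (last_contra hp).elim
  obtain ⟨p', hp⟩ := sg_bpre (p := p ++ [false] ++ false :: u1)
      (q := false :: u1 ++ [false] ++ q) (by simpa using h)
  obtain ⟨u2, hu2⟩ : ∃ u2, false :: u1 = u2 ++ [false] := by
    rcases List.eq_nil_or_concat u1 with rfl | ⟨u2, d, rfl⟩
    · exact ⟨[], rfl⟩
    · rcases d with _ | _
      · exact ⟨false :: u2, by simp⟩
      · exfalso
        apply last_contra (p := p ++ [false] ++ false :: u2) (p' := p')
        rw [← hp]; simp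
  rw [hu2] at h ⊢
  -- p | a | u2 | ab | u2 | a | a q
  obtain ⟨z1, z2, hz, h1, h2⟩ := sg_cut (z := Fw k) (p := p)
    (q := u2 ++ [false] ++ [true] ++ u2 ++ [false] ++ [false] ++ q) (by simpa using h)
  rcases append_singleton_cons _ _ _ _ hu2.symm with rfl | ⟨u3, rfl⟩
  · rfl
  obtain ⟨z3, z4, rfl, h3, h4⟩ := sg_cut (z := z2) (p := [false])
    (q := u3 ++ [false] ++ [true] ++ false :: u3 ++ [false] ++ [false] ++ q) (by simpa using h2)
  obtain ⟨z5, z6, rfl, h5, h6⟩ := sg_cut (z := z4) (p := false :: u3)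
    (q := [true] ++ false :: u3 ++ [false] ++ [false] ++ q) (by simpa using h4)
  obtain ⟨z7, z8, rfl, h7, h8⟩ := sg_cut (z := z6) (p := [false, true])
    (q := u3 ++ [false] ++ [false] ++ q) (by simpa using h6)
  obtain ⟨z9, z10, rfl, h9, h10⟩ := sg_cut (z := z8) (p := false :: u3)
    (q := [false] ++ q) (by simpa using h8)
  obtain ⟨z11, rfl⟩ := sg_aa (q := q) (by simpa using h10)
  have e1 := sg_eq_a h3
  have e2 := sg_eq_ab h7
  have e3 : z9 = z5 := sg_inj (h9.trans h5.symm)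
  subst e1 e2 e3
  have := Fw_bxaxb k z9 z1 z11 (by rw [hz]; simp)
  subst this
  simp [sg] at h5

theorem Fw_ne_nil (k : ℕ) : Fw k ≠ [] := by
  induction k using Nat.strong_induction_on with
  | _ k ih =>
    match k with
    | 0 => simp [Fw]
    | 1 => simp [Fw]
    | k + 2 => simp [Fw, ih k (by omega)]

theorem Fw_succ_prefix (k : ℕ) : ∃ r, r ≠ [] ∧ Fw (k + 1) = Fw k ++ r := by
  rcases k with _ | k
  · exact ⟨[true], by simp, rfl⟩
  · exact ⟨Fw k, Fw_ne_nil k, rfl⟩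

theorem Fw_lift {k : ℕ} {p w q : List Bool} (h : Fw k = p ++ w ++ q) :
    ∃ k' p' q', Fw (k' + 1) = p' ++ w ++ q' ∧ p' ≠ [] ∧ q' ≠ [] := by
  obtain ⟨r, hr, e⟩ := Fw_succ_prefix k
  refine ⟨k + 2, Fw (k + 2) ++ p, q ++ r, ?_, ?_, ?_⟩
  · rw [Fw, e, h]; simp
  · simp [Fw_ne_nil]
  · simp [hr]

theorem sg_rotated {u v : List Bool} (h : u ~r v) : sg u ~r sg v := by
  obtain ⟨n, rfl⟩ := h
  rw [List.rotate_eq_drop_append_take_mod]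
  conv_lhs => rw [← List.take_append_drop (n % u.length) u]
  rw [sg_append, sg_append]
  exact List.isRotated_append

theorem sg_length_le (u : List Bool) : u.length ≤ (sg u).length := by
  induction u with
  | nil => simp
  | cons c u ih => cases c <;> simp [sg] <;> omega

theorem sg_length_lt {u : List Bool} (h : false ∈ u) : u.length < (sg u).length := by
  induction u with
  | nil => simp at h
  | cons c u ih =>
    have := sg_length_le u
    cases c
    · simp [sg]; omega
    · simp [sg] at h ⊢; exact ih h

theorem mem_false_of_square {k : ℕ} {u p q : List Bool} (hu : u ≠ [])
    (h : Fw k = p ++ u ++ u ++ q) : false ∈ u := by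
  by_contra hc
  obtain ⟨c, u1, rfl⟩ := List.exists_cons_of_ne_nil hu
  rcases c with _ | _
  · simp at hc
  rcases List.eq_nil_or_concat u1 with rfl | ⟨u2, d, rfl⟩
  · exact Fw_no_bb k p q (by rw [h]; simp)
  · rcases d with _ | _
    · simp at hc
    · exact Fw_no_bb k (p ++ true :: u2) (u2 ++ [true] ++ q) (by rw [h]; simp)

/-- One desubstitution step for squares. -/
theorem square_step (k : ℕ) (v p q : List Bool) (hv : v ≠ [])
    (h : Fw (k + 1) = p ++ v ++ v ++ q) (hp : p ≠ []) (hq : q ≠ []) :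
    (∃ m, v ~r Fw m) ∨ ∃ u p' q', u ≠ [] ∧ Fw k = p' ++ u ++ u ++ q' ∧ v ~r sg u := by
  have key : ∀ (w x y : List Bool), sg (Fw k) = x ++ false :: w ++ false :: w ++ false :: y →
      ∃ u p' q', u ≠ [] ∧ Fw k = p' ++ u ++ u ++ q' ∧ sg u = false :: w := by
    intro w x y h
    obtain ⟨z1, z2, hz, h1, h2⟩ := sg_cut (z := Fw k) (p := x)
      (q := w ++ false :: w ++ false :: y) (by simpa using h)
    obtain ⟨z3, z4, rfl, h3, h4⟩ := sg_cut (z := z2) (p := false :: w)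
      (q := w ++ false :: y) (by simpa using h2)
    obtain ⟨z5, z6, rfl, h5, h6⟩ := sg_cut (z := z4) (p := false :: w)
      (q := y) (by simpa using h4)
    have e : z5 = z3 := sg_inj (h5.trans h3.symm)
    subst e
    refine ⟨z5, z1, z6, ?_, by rw [hz]; simp, h3⟩
    rintro rfl
    simp [sg] at h3
  rw [← sg_Fw] at h
  obtain ⟨c, v1, rfl⟩ := List.exists_cons_of_ne_nil hv
  obtain ⟨d, q1, rfl⟩ := List.exists_cons_of_ne_nil hq
  rcases c with _ | _
  · rcases d with _ | _
    · obtain ⟨u, p', q', hu, hk, hs⟩ := key v1 p q1 h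
      exact Or.inr ⟨u, p', q', hu, hk, by rw [hs]⟩
    · -- next letter is `b`
      obtain ⟨r, hr⟩ := sg_bpre h
      obtain ⟨v0, hv0⟩ : ∃ v0, false :: v1 = v0 ++ [false] := by
        rcases List.eq_nil_or_concat v1 with rfl | ⟨v2, e, rfl⟩
        · exact ⟨[], rfl⟩
        · rcases e with _ | _
          · exact ⟨false :: v2, by simp⟩
          · exfalso
            apply last_contra (p := p ++ false :: (v2 ++ [true]) ++ false :: v2) (p' := r)
            rw [← hr]; simp
      rw [hv0] at h ⊢
      rcases List.eq_nil_or_concat p with rfl | ⟨p1, e, rfl⟩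
      · exact absurd rfl hp
      rcases e with _ | _
      · obtain ⟨u, p', q', hu, hk, hs⟩ := key v0 p1 (true :: q1) (by rw [h]; simp)
        refine Or.inr ⟨u, p', q', hu, hk, ?_⟩
        rw [hs]
        exact List.isRotated_append
      · left
        obtain ⟨p2, rfl⟩ := sg_bpre (z := Fw k) (p := p1)
          (q := v0 ++ [false] ++ (v0 ++ [false]) ++ true :: q1) (by rw [h]; simp)
        obtain ⟨z1, z2, hz, h1, h2⟩ := sg_cut (z := Fw k) (p := p2)
          (q := true :: v0 ++ [false] ++ v0 ++ [false] ++ true :: q1) (by simpa using h)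
        rcases append_singleton_cons _ _ _ _ hv0.symm with rfl | ⟨v3, rfl⟩
        · exact ⟨0, by simp [Fw]⟩
        obtain ⟨z3, z4, rfl, h3, h4⟩ := sg_cut (z := z2) (p := [false, true])
          (q := v3 ++ [false] ++ false :: v3 ++ [false] ++ true :: q1) (by simpa using h2)
        obtain ⟨z5, z6, rfl, h5, h6⟩ := sg_cut (z := z4) (p := false :: v3)
          (q := false :: v3 ++ [false] ++ true :: q1) (by simpa using h4)
        obtain ⟨z7, z8, rfl, h7, h8⟩ := sg_cut (z := z6) (p := [false])
          (q := v3 ++ [false] ++ true :: q1) (by simpa using h6)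
        obtain ⟨z9, z10, rfl, h9, h10⟩ := sg_cut (z := z8) (p := false :: v3)
          (q := true :: q1) (by simpa using h8)
        obtain ⟨z11, rfl⟩ := sg_ab h10
        have e1 := sg_eq_ab h3
        have e2 := sg_eq_a h7
        have e3 : z9 = z5 := sg_inj (h9.trans h5.symm)
        subst e1 e2 e3
        rcases Fw_aubua k z9 z1 z11 (by rw [hz]; simp) with rfl | rfl
        · simp [sg] at h5
        · rw [← h5]
          exact ⟨2, List.IsRotated.refl _⟩
  · -- starts with `b`
    obtain ⟨p1, rfl⟩ := sg_bpre (z := Fw k) (p := p) (q := v1 ++ true :: v1 ++ d :: q1)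
      (by simpa using h)
    obtain ⟨r, hr⟩ := sg_bpre (z := Fw k) (p := p1 ++ [false] ++ true :: v1)
      (q := v1 ++ d :: q1) (by simpa using h)
    rcases List.eq_nil_or_concat v1 with rfl | ⟨v2, e, rfl⟩
    · exact (last_contra hr).elim
    · rcases e with _ | _
      · obtain ⟨u, p', q', hu, hk, hs⟩ := key (true :: v2) p1 (d :: q1) (by rw [h]; simp)
        refine Or.inr ⟨u, p', q', hu, hk, ?_⟩
        rw [hs]
        have := List.isRotated_append (l := true :: v2) (l' := [false])
        simpa using this
      · exfalso
        apply last_contra (p := p1 ++ [false] ++ true :: v2) (p' := r)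
        rw [← hr]; simp

/-- Squares in the Fibonacci word are squares of conjugates of finite Fibonacci words. -/
theorem square_conj (N : ℕ) : ∀ (v : List Bool), v.length ≤ N → v ≠ [] →
    ∀ (k : ℕ) (p q : List Bool), Fw k = p ++ v ++ v ++ q → ∃ m, v ~r Fw m := by
  induction N with
  | zero =>
    intro v hl hv
    exact absurd (List.length_eq_zero_iff.mp (by omega)) hv
  | succ N ih =>
    intro v hl hv k p q h
    obtain ⟨k', p', q', h', hp, hq⟩ := Fw_lift (w := v ++ v) (p := p) (q := q) (k := k)
      (by rw [h]; simp)
    rcases square_step k' v p' q' hv (by rw [h']; simp) hp hq with hm | ⟨u, p2, q2, hu, hk, hr⟩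
    · exact hm
    · have h1 := sg_length_lt (mem_false_of_square hu hk)
      have h2 := hr.perm.length_eq
      obtain ⟨m, hm⟩ := ih u (by omega) hu k' p2 q2 hk
      exact ⟨m + 1, hr.trans (by rw [← sg_Fw]; exact sg_rotated hm)⟩

/-! ### Primitivity -/

theorem comm_count (N : ℕ) : ∀ p q : List Bool, p.length + q.length ≤ N → p ++ q = q ++ p →
    p.length * q.count true = q.length * p.count true := by
  induction N with
  | zero =>
    intro p q h _
    have h1 : p = [] := List.length_eq_zero_iff.mp (by omega)
    have h2 : q = [] := List.length_eq_zero_iff.mp (by omega)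
    simp [h1, h2]
  | succ N ih =>
    have main : ∀ p q : List Bool, p.length ≤ q.length → p.length + q.length ≤ N + 1 →
        p ++ q = q ++ p → p.length * q.count true = q.length * p.count true := by
      intro p q hle h e
      rcases Nat.eq_zero_or_pos p.length with h0 | h0
      · have h1 : p = [] := List.length_eq_zero_iff.mp (by omega)
        simp [h1]
      have hpre : p <+: q := by
        have h1 : p <+: q ++ p := ⟨q, e⟩
        exact List.prefix_of_prefix_length_le h1 (List.prefix_append _ _) hle
      obtain ⟨r, rfl⟩ := hpre
      have e' : p ++ r = r ++ p := by simpa using e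
      have := ih p r (by simp at h; omega) e'
      simp [List.count_append]
      nlinarith
    intro p q h e
    rcases le_total p.length q.length with hle | hle
    · exact main p q hle h e
    · exact (main q p hle (by omega) e.symm).symm

theorem fn_add_two (m : ℕ) : fn (m + 2) = fn (m + 1) + fn m := by
  unfold fn
  rw [Nat.fib_add_two (n := m + 2), Nat.add_comm]

theorem fn_zero : fn 0 = 1 := rfl
theorem fn_one : fn 1 = 2 := rfl

theorem fn_pos (m : ℕ) : 0 < fn m := Nat.fib_pos.mpr (by omega)

theorem Fw_length (m : ℕ) : (Fw m).length = fn m := by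
  induction m using Nat.strong_induction_on with
  | _ k ih =>
    match k with
    | 0 => rfl
    | 1 => rfl
    | k + 2 => rw [fn_add_two, Fw, List.length_append, ih (k + 1) (by omega), ih k (by omega)]

theorem Fw_count (m : ℕ) : (Fw m).count true = Nat.fib m := by
  induction m using Nat.strong_induction_on with
  | _ k ih =>
    match k with
    | 0 => rfl
    | 1 => rfl
    | k + 2 =>
      rw [Fw, List.count_append, ih (k + 1) (by omega), ih k (by omega), Nat.fib_add_two]
      omega

theorem fn_coprime (m : ℕ) : Nat.Coprime (fn m) (Nat.fib m) := by
  unfold fn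
  rw [Nat.fib_add_two]
  have := Nat.fib_coprime_fib_succ m
  simpa [Nat.coprime_comm] using this

theorem Fw_rotate_ne (m d : ℕ) (hd : d < fn m) (h : (Fw m).rotate d = Fw m) : d = 0 := by
  rw [List.rotate_eq_drop_append_take (by rw [Fw_length]; omega)] at h
  have e : (Fw m).drop d ++ (Fw m).take d = (Fw m).take d ++ (Fw m).drop d := by
    rw [h, List.take_append_drop]
  have hc := comm_count _ _ _ le_rfl e
  have ht : ((Fw m).take d).count true + ((Fw m).drop d).count true = Nat.fib m := by
    rw [← List.count_append, List.take_append_drop, Fw_count]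
  rw [List.length_drop, List.length_take, Fw_length, min_eq_left hd.le] at hc
  obtain ⟨e, he⟩ := Nat.exists_eq_add_of_le hd.le
  have h1 : fn m * ((Fw m).take d).count true = d * Nat.fib m := by
    rw [← ht]
    have : fn m - d = e := by omega
    rw [this] at hc
    nlinarith
  have h2 : fn m ∣ d := (fn_coprime m).dvd_of_dvd_mul_right ⟨_, h1.symm⟩
  exact Nat.eq_zero_of_dvd_of_lt h2 hd

theorem Fw_rotate_inj (m i j : ℕ) (hi : i < fn m) (hj : j < fn m)
    (h : (Fw m).rotate i = (Fw m).rotate j) : i = j := by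
  have main : ∀ i j, i ≤ j → j < fn m → (Fw m).rotate i = (Fw m).rotate j → i = j := by
    intro i j hij hj h
    obtain ⟨d, rfl⟩ := Nat.exists_eq_add_of_le hij
    have h' : ((Fw m).rotate d).rotate i = (Fw m).rotate i := by
      rw [List.rotate_rotate, h, Nat.add_comm]
    have := Fw_rotate_ne m d (by omega) (List.rotate_injective i h')
    omega
  rcases le_total i j with hij | hij
  · exact main i j hij hj h
  · exact (main j i hij hi h.symm).symm

/-! ### The infinite word -/

theorem fn_lt_succ (m : ℕ) : fn m < fn (m + 1) := by
  rcases m with _ | m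
  · decide
  · rw [fn_add_two]
    have := fn_pos m
    omega

theorem fn_mono {a b : ℕ} (h : a ≤ b) : fn a ≤ fn b := Nat.fib_mono (by omega)

theorem lt_fn (i : ℕ) : i < fn i := by
  induction i with
  | zero => decide
  | succ i ih =>
    have := fn_lt_succ i
    omega

theorem Fw_prefix {a b : ℕ} (h : a ≤ b) : Fw a <+: Fw b := by
  induction b, h using Nat.le_induction with
  | base => exact List.prefix_rfl
  | succ b _ ih =>
    obtain ⟨r, _, hr⟩ := Fw_succ_prefix b
    exact ih.trans ⟨r, hr.symm⟩

theorem Fw_getElem? (k i : ℕ) (h : i < fn k) : (Fw k)[i]? = some (fibWord i) := by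
  have aux : ∀ a b, a ≤ b → i < fn a → (Fw a)[i]? = (Fw b)[i]? := by
    intro a b hab hi
    obtain ⟨r, hr⟩ := Fw_prefix hab
    rw [← hr, List.getElem?_append_left (by rw [Fw_length]; exact hi)]
  have hi : i < fn (i + 1) := (lt_fn i).trans (fn_lt_succ i)
  have e : (Fw k)[i]? = (Fw (i + 1))[i]? := by
    rcases le_total k (i + 1) with hk | hk
    · exact aux _ _ hk h
    · exact (aux _ _ hk hi).symm
  rw [e, fibWord, List.getD_eq_getElem?_getD]
  rw [List.getElem?_eq_getElem (by rw [Fw_length]; exact hi)]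
  simp

/-- factor of length `l` starting at (0-indexed) position `st`. -/
def fac (st l : ℕ) : List Bool := (List.range l).map fun t => fibWord (st + t)

theorem fac_length (st l : ℕ) : (fac st l).length = l := by simp [fac]

theorem fac_getElem? (st l t : ℕ) (h : t < l) : (fac st l)[t]? = some (fibWord (st + t)) := by
  simp [fac, h]

theorem Fw_eq_fac (k : ℕ) : Fw k = fac 0 (fn k) := by
  apply List.ext_getElem?
  intro i
  by_cases h : i < fn k
  · rw [Fw_getElem? k i h, fac_getElem? _ _ _ h, Nat.zero_add]
  · rw [List.getElem?_eq_none (by rw [Fw_length]; omega),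
      List.getElem?_eq_none (by rw [fac_length]; omega)]

theorem fac_add (st a b : ℕ) : fac st (a + b) = fac st a ++ fac (st + a) b := by
  simp [fac, List.range_add, Nat.add_assoc]

theorem fac_congr {a b l : ℕ} (h : ∀ t < l, fibWord (a + t) = fibWord (b + t)) :
    fac a l = fac b l := by
  unfold fac
  apply List.map_congr_left
  intro t ht
  exact h t (List.mem_range.mp ht)

theorem fac_inj {a b l : ℕ} (h : fac a l = fac b l) (t : ℕ) (ht : t < l) :
    fibWord (a + t) = fibWord (b + t) := by
  have h1 := fac_getElem? a l t ht
  rw [h, fac_getElem? b l t ht] at h1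
  exact (Option.some.inj h1).symm

/-- copying: `F[f_{m+1}+j] = F[j]` for `j < f_m`. -/
theorem F_copy (m j : ℕ) (h : j < fn m) : fibWord (fn (m + 1) + j) = fibWord j := by
  have h1 := Fw_getElem? (m + 2) (fn (m + 1) + j) (by rw [fn_add_two]; omega)
  rw [Fw, List.getElem?_append_right (by rw [Fw_length]; omega), Fw_length,
    Nat.add_sub_cancel_left, Fw_getElem? m j h] at h1
  exact (Option.some.inj h1).symm

/-- near-commutation. -/
theorem F_near (m : ℕ) : (∀ i, i + 2 < fn (m + 1) → fibWord (fn m + i) = fibWord i) ∧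
    (∀ i, fn (m + 1) ≤ i + 2 → i < fn (m + 1) → fibWord (fn m + i) ≠ fibWord i) := by
  induction m with
  | zero =>
    constructor
    · intro i hi
      simp [fn_one] at hi
    · intro i _ hi
      simp [fn_one] at hi
      interval_cases i <;> decide
  | succ m ih =>
    have e : fn (m + 1 + 1) = fn (m + 1) + fn m := fn_add_two m
    constructor
    · intro i hi
      by_cases h : i < fn m
      · exact F_copy m i h
      · obtain ⟨j, rfl⟩ := Nat.exists_eq_add_of_le (not_lt.mp h)
        rw [← Nat.add_assoc, ← e, F_copy (m + 1) j (by omega), ih.1 j (by omega)]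
    · intro i h1 h2
      have h3 : fn m ≤ i ∨ m = 0 := by
        rcases m with _ | m
        · exact Or.inr rfl
        · left
          have := fn_pos m
          have h4 : fn 1 ≤ fn (m + 1) := fn_mono (by omega)
          have h5 : fn 1 ≤ fn (m + 1 + 1) := fn_mono (by omega)
          rw [fn_one] at h4 h5
          omega
      rcases h3 with h3 | rfl
      · obtain ⟨j, rfl⟩ := Nat.exists_eq_add_of_le h3
        rw [← Nat.add_assoc, ← e, F_copy (m + 1) j (by omega)]
        exact (ih.2 j (by omega) (by omega)).symm
      · simp [fn_one, fn_zero] at e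
        rw [e] at h1 h2
        have : fn (0 + 1) = 2 := rfl
        rw [this]
        have : 1 ≤ i := by omega
        interval_cases i <;> decide

theorem F_second (m i : ℕ) (h : i + 2 < fn (m + 2)) :
    fibWord (fn (m + 1) + i) = fibWord i ∧ fibWord (fn (m + 1) + i + fn m) = fibWord i := by
  have h3 : fn (m + 2) < fn (m + 2 + 1) := fn_lt_succ _
  refine ⟨(F_near (m + 1)).1 i h, ?_⟩
  have := (F_near (m + 2)).1 i (by omega)
  rw [← this, fn_add_two]
  congr 1
  omega

theorem rotate_eq_fac (m j : ℕ) (hj : j < fn m) : (Fw m).rotate j = fac j (fn m) := by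
  rw [List.rotate_eq_drop_append_take (by rw [Fw_length]; omega)]
  obtain ⟨e, he⟩ := Nat.exists_eq_add_of_le hj.le
  have h1 : Fw m = fac 0 j ++ fac j e := by
    rw [Fw_eq_fac, he, fac_add, Nat.zero_add]
  rw [h1, List.drop_left' (fac_length _ _), List.take_left' (fac_length _ _), he,
    Nat.add_comm j e, fac_add, Nat.add_comm j e, Nat.add_comm e j, ← he]
  congr 1
  apply fac_congr
  intro t ht
  have := fn_lt_succ m
  rw [(F_near m).1 t (by omega), Nat.zero_add]

theorem rotate_eq_fac2 (m j : ℕ) (hj : j < fn m) :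
    (Fw m).rotate j = fac (fn (m + 1) + j) (fn m) := by
  rw [rotate_eq_fac m j hj]
  apply fac_congr
  intro t ht
  have := fn_lt_succ m
  have := fn_add_two m
  rw [Nat.add_assoc, (F_second m (j + t) (by omega)).1]

/-! ### Characterisation of (2+ε)-powers -/

theorem infix_iff (v : List Bool) (n : ℕ) : v <:+: fFactor 1 n ↔
    ∃ st, st + v.length ≤ n ∧ v = fac st v.length := by
  have e : fFactor 1 n = fac 0 n := rfl
  rw [e]
  constructor
  · rintro ⟨x, y, h⟩
    have hl := congrArg List.length h
    simp [fac_length] at hl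
    refine ⟨x.length, by omega, ?_⟩
    have h2 : n = x.length + (v.length + y.length) := by omega
    rw [h2, fac_add, fac_add, List.append_assoc] at h
    have h3 := (List.append_inj h (by simp [fac_length])).2
    have h4 := (List.append_inj h3 (by simp [fac_length])).1
    simpa using h4
  · rintro ⟨st, h1, h2⟩
    obtain ⟨r, rfl⟩ := Nat.exists_eq_add_of_le h1
    refine ⟨fac 0 st, fac (st + v.length) r, ?_⟩
    rw [fac_add, fac_add, Nat.zero_add, Nat.zero_add, ← h2]

theorem power_iff (w : List Bool) (n : ℕ) :
    (w ≠ [] ∧ (w ++ w ++ [w.headI]) <:+: fFactor 1 n) ↔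
    ∃ st s, 0 < s ∧ w = fac st s ∧ st + 2 * s + 1 ≤ n ∧
      ∀ i, st ≤ i → i ≤ st + s → fibWord i = fibWord (i + s) := by
  have head : ∀ st s, 0 < s → [(fac st s).headI] = fac st 1 := by
    intro st s hs
    obtain ⟨r, rfl⟩ := Nat.exists_eq_add_of_le hs
    rw [fac_add]
    simp [fac]
  rw [infix_iff]
  constructor
  · rintro ⟨hw, st, h1, h2⟩
    have hs : 0 < w.length := List.length_pos_iff.mpr hw
    have hl : (w ++ w ++ [w.headI]).length = w.length + w.length + 1 := by
      simp; omega
    rw [hl] at h1 h2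
    rw [fac_add, fac_add] at h2
    have h3 := List.append_inj h2 (by simp [fac_length])
    have h4 := List.append_inj h3.1 (by simp [fac_length])
    refine ⟨st, w.length, hs, h4.1, by omega, ?_⟩
    have h5 : fac st w.length = fac (st + w.length) w.length := h4.1.symm.trans h4.2
    have h6 : fac st 1 = fac (st + (w.length + w.length)) 1 := by
      rw [← head st w.length hs, ← h4.1]
      exact h3.2
    intro i hi1 hi2
    obtain ⟨t, rfl⟩ := Nat.exists_eq_add_of_le hi1
    by_cases ht : t < w.length
    · rw [fac_inj h5 t ht]
      congr 1
      omega
    · have : t = w.length := by omega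
      subst this
      have a := fac_inj h5 0 hs
      have b := fac_inj h6 0 (by omega)
      simp only [Nat.add_zero] at a b
      rw [← a, b]
      congr 1
      omega
  · rintro ⟨st, s, hs, rfl, h1, h2⟩
    have hl : (fac st s ++ fac st s ++ [(fac st s).headI]).length = s + s + 1 := by
      simp [fac_length]; omega
    refine ⟨?_, st, ?_, ?_⟩
    · intro h
      have := congrArg List.length h
      simp [fac_length] at this
      omega
    · rw [hl]; omega
    · rw [hl, fac_add, fac_add, head st s hs]
      congr 1
      · congr 1
        apply fac_congr
        intro t ht
        rw [h2 (st + t) (by omega) (by omega)]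
        congr 1
        omega
      · apply fac_congr
        intro t ht
        have : t = 0 := by omega
        subst this
        rw [Nat.add_zero, h2 st (by omega) (by omega), h2 (st + s) (by omega) (by omega)]
        congr 1
        omega

theorem fac_in_Fw (st l : ℕ) : ∃ k x y, Fw k = x ++ fac st l ++ y := by
  have h := lt_fn (st + l)
  obtain ⟨r, hr⟩ := Nat.exists_eq_add_of_le h.le
  refine ⟨st + l, fac 0 st, fac (st + l) r, ?_⟩
  rw [Fw_eq_fac, hr, fac_add, fac_add, Nat.zero_add, Nat.zero_add]

theorem power_conj (st s : ℕ) (hs : 0 < s)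
    (h : ∀ i, st ≤ i → i ≤ st + s → fibWord i = fibWord (i + s)) :
    ∃ m j, s = fn m ∧ j < fn m ∧ fac st s = (Fw m).rotate j := by
  obtain ⟨k, x, y, hk⟩ := fac_in_Fw st (s + s)
  have e : fac (st + s) s = fac st s := by
    apply fac_congr
    intro t ht
    rw [h (st + t) (by omega) (by omega)]
    congr 1
    omega
  rw [fac_add, e] at hk
  obtain ⟨m, hm⟩ := square_conj _ (fac st s) le_rfl
    (by intro h0
        have := congrArg List.length h0
        simp [fac_length] at this
        omega) k x y (by rw [hk]; simp)
  have hl := hm.perm.length_eq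
  rw [fac_length, Fw_length] at hl
  obtain ⟨j, hj, hr⟩ := List.isRotated_iff_mod.mp hm.symm
  by_cases hj' : j < fn m
  · exact ⟨m, j, hl, hj', hr.symm⟩
  · refine ⟨m, 0, hl, fn_pos m, ?_⟩
    rw [Fw_length] at hj
    have : j = (Fw m).length := by rw [Fw_length]; omega
    rw [← hr, this]
    simp

theorem no_aaa (st : ℕ) : ¬ (fibWord st = fibWord (st + 1) ∧ fibWord (st + 1) = fibWord (st + 2)) := by
  rintro ⟨h1, h2⟩
  obtain ⟨k, x, y, hk⟩ := fac_in_Fw st 3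
  have e : fac st 3 = [fibWord st, fibWord (st + 1), fibWord (st + 2)] := rfl
  rw [e, ← h2, ← h1] at hk
  cases hb : fibWord st
  · rw [hb] at hk
    exact Fw_no_aaa k x y (by rw [hk]; simp)
  · rw [hb] at hk
    exact Fw_no_bb k x (true :: y) (by rw [hk]; simp)

theorem no_babab (st : ℕ) (h : fac st 2 = [true, false])
    (hp : ∀ i, st ≤ i → i ≤ st + 2 → fibWord i = fibWord (i + 2)) : False := by
  obtain ⟨k, x, y, hk⟩ := fac_in_Fw st 5
  have e : fac st 5 = [fibWord st, fibWord (st + 1), fibWord (st + 2), fibWord (st + 3),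
    fibWord (st + 4)] := rfl
  have e2 : fac st 2 = [fibWord st, fibWord (st + 1)] := rfl
  rw [e2] at h
  simp at h
  have h2 := hp st (by omega) (by omega)
  have h3 := hp (st + 1) (by omega) (by omega)
  have h4 := hp (st + 2) (by omega) (by omega)
  rw [e, ← h4, ← h3, ← h2, h.1, h.2] at hk
  exact Fw_no_babab k x y (by rw [hk]; simp)

/-! ### Counting -/

/-- number of conjugates of `Fw m` whose (2+ε)-power occurs in `F[1,n]`. -/
def cc (n h m : ℕ) : ℕ :=
  if m = 0 then 0 else if m = 1 then 1 else
  if m = h then min (n - 2 * fn h) (fn (h - 1) - 2) else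
  if m + 1 = h then max (fn (h - 2) - 2) (min (fn (h - 1)) (n - fn (h + 1) - fn (h - 1))) else fn m

/-- First-run occurrence. -/
theorem run_first (n m j : ℕ) (hj : j + fn m + 2 < fn (m + 1)) (hn : j + 2 * fn m + 1 ≤ n)
    (hjm : j < fn m) : ∃ st s, 0 < s ∧ (Fw m).rotate j = fac st s ∧ st + 2 * s + 1 ≤ n ∧
      ∀ i, st ≤ i → i ≤ st + s → fibWord i = fibWord (i + s) := by
  refine ⟨j, fn m, fn_pos m, rotate_eq_fac m j hjm, hn, ?_⟩
  intro i h1 h2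
  rw [Nat.add_comm, (F_near m).1 i (by omega)]

/-- Second-run occurrence. -/
theorem run_second (n m j : ℕ) (hm : 2 ≤ m) (hjm : j < fn m)
    (hn : fn (m + 1) + j + 2 * fn m + 1 ≤ n) :
    ∃ st s, 0 < s ∧ (Fw m).rotate j = fac st s ∧ st + 2 * s + 1 ≤ n ∧
      ∀ i, st ≤ i → i ≤ st + s → fibWord i = fibWord (i + s) := by
  refine ⟨fn (m + 1) + j, fn m, fn_pos m, rotate_eq_fac2 m j hjm, hn, ?_⟩
  intro i h1 h2
  obtain ⟨t, rfl⟩ := Nat.exists_eq_add_of_le (show fn (m + 1) ≤ i by omega)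
  obtain ⟨m, rfl⟩ := Nat.exists_eq_add_of_le hm
  have e1 : fn (2 + m + 1) = fn (2 + m) + fn (m + 1) := by
    rw [show 2 + m + 1 = m + 1 + 2 by omega, fn_add_two, show m + 1 + 1 = 2 + m by omega]
  have e2 : fn (2 + m + 2) = fn (2 + m + 1) + fn (2 + m) := fn_add_two _
  have e3 : fn 1 ≤ fn (m + 1) := fn_mono (by omega)
  rw [fn_one] at e3
  have := F_second (2 + m) t (by omega)
  rw [this.1, this.2]

theorem power_set (n h : ℕ) (hn : 9 ≤ n) (hh : 2 ≤ h)
    (h1 : 2 * fn h ≤ n) (h2 : n < 2 * fn (h + 1)) :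
    {w : List Bool | w ≠ [] ∧ (w ++ w ++ [w.headI]) <:+: fFactor 1 n} =
      (((Finset.range (h + 1)).sigma fun m => Finset.range (cc n h m)).image
        fun x : (_ : ℕ) × ℕ => (Fw x.1).rotate x.2 : Finset (List Bool)) := by
  obtain ⟨g, rfl⟩ := Nat.exists_eq_add_of_le' hh
  have r1 : fn (g + 2) = fn (g + 1) + fn g := fn_add_two g
  have r2 : fn (g + 2 + 1) = fn (g + 2) + fn (g + 1) := fn_add_two (g + 1)
  have s1 : g + 2 - 1 = g + 1 := rfl
  have s2 : g + 2 - 2 = g := rfl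
  have p0 := fn_pos g
  have l0 : fn g < fn (g + 1) := fn_lt_succ g
  ext w
  rw [Set.mem_ofPred_eq, power_iff]
  simp only [Finset.coe_image, Set.mem_image, Finset.mem_coe, Finset.mem_sigma, Finset.mem_range]
  constructor
  · rintro ⟨st, s, hs, rfl, hst, hp⟩
    obtain ⟨m, j, rfl, hj, hr⟩ := power_conj st s hs hp
    refine ⟨⟨m, j⟩, ⟨?_, ?_⟩, hr.symm⟩
    · by_contra hc
      have : fn (g + 2 + 1) ≤ fn m := fn_mono (by simpa using hc)
      omega
    · show j < cc n (g + 2) m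
      unfold cc
      split_ifs with c0 c1 c2 c3
      · subst c0
        exfalso
        rw [fn_zero] at hp
        exact no_aaa st ⟨hp st (by omega) (by omega), hp (st + 1) (by omega) (by omega)⟩
      · subst c1
        rw [fn_one] at hp hr hj
        rcases Nat.eq_zero_or_pos j with hj0 | hj0
        · omega
        · have : j = 1 := by omega
          subst this
          exact (no_babab st hr hp).elim
      · subst c2
        rw [s1]
        have hmis : st + fn (g + 2) + 2 < fn (g + 2 + 1) := by
          by_contra hc
          have := (F_near (g + 2)).2 (max st (fn (g + 2 + 1) - 2)) (by omega) (by omega)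
          apply this
          rw [Nat.add_comm]
          exact (hp _ (by omega) (by omega)).symm
        have := Fw_rotate_inj _ j st hj (by omega)
          (by rw [← hr, rotate_eq_fac _ _ (by omega)])
        omega
      · have c3' : m = g + 1 := by omega
        subst c3'
        rw [s1, s2]
        change st + 2 * fn (g + 1) + 1 ≤ n at hst
        by_cases hmis : st + fn (g + 1) + 2 < fn (g + 2)
        · have := Fw_rotate_inj _ j st hj (by omega)
            (by rw [← hr, rotate_eq_fac _ _ (by omega)])
          omega
        · have hst2 : fn (g + 2) ≤ st := by
            by_contra hc
            have := (F_near (g + 1)).2 (max st (fn (g + 2) - 2))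
              (show fn (g + 2) ≤ _ by omega) (show _ < fn (g + 2) by omega)
            apply this
            rw [Nat.add_comm]
            exact (hp _ (by omega) (by omega)).symm
          obtain ⟨i, rfl⟩ := Nat.exists_eq_add_of_le hst2
          by_cases hi : i < fn (g + 1)
          · have := Fw_rotate_inj _ j i hj hi
              (by rw [← hr, rotate_eq_fac2 _ _ hi])
            omega
          · omega
      · exact hj
  · rintro ⟨⟨m, j⟩, ⟨hm, hj⟩, rfl⟩
    simp only at hm hj ⊢
    unfold cc at hj
    rw [s1, s2] at hj
    split_ifs at hj with c0 c1 c2 c3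
    · omega
    · subst c1
      have : j = 0 := by omega
      subst this
      refine ⟨3, 2, by omega, by decide, by omega, ?_⟩
      intro i h1 h2
      interval_cases i <;> decide
    · subst c2
      exact run_first _ _ _ (by omega) (by omega) (by omega)
    · have c3' : m = g + 1 := by omega
      subst c3'
      by_cases hjf : j < fn g - 2
      · exact run_first _ _ _ (show _ < fn (g + 2) by omega) (by omega) (by omega)
      · exact run_second _ _ _ (by omega) (by omega) (show fn (g + 2) + _ + _ + _ ≤ _ by omega)
    · obtain ⟨d, rfl⟩ := Nat.exists_eq_add_of_le' (show 2 ≤ g by omega)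
      have q1 : fn (d + 2 + 1) = fn (d + 2) + fn (d + 1) := fn_add_two _
      have q2 : fn (d + 2) = fn (d + 1) + fn d := fn_add_two _
      have q3 : fn m ≤ fn (d + 2) := fn_mono (by omega)
      have q4 : fn (m + 1) ≤ fn (d + 2 + 1) := fn_mono (by omega)
      exact run_second _ _ _ (by omega) hj (by omega)

theorem sum_low (n g : ℕ) : ∑ m ∈ Finset.range (g + 2), cc n (g + 3) m + 4 = fn (g + 3) := by
  have aux : ∀ k, k ≤ g → ∑ m ∈ Finset.range (k + 2), cc n (g + 3) m + 4 = fn (k + 3) := by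
    intro k
    induction k with
    | zero =>
      intro _
      simp [Finset.sum_range_succ, cc]
      rfl
    | succ k ih =>
      intro hk
      have e : fn (k + 1 + 3) = fn (k + 3) + fn (k + 2) := fn_add_two (k + 2)
      rw [Finset.sum_range_succ, e, ← ih (by omega)]
      have : cc n (g + 3) (k + 1 + 1) = fn (k + 2) := by
        unfold cc
        rw [if_neg (by omega), if_neg (by omega), if_neg (by omega), if_neg (by omega)]
      show ∑ x ∈ Finset.range (k + 2), cc n (g + 3) x + cc n (g + 3) (k + 1 + 1) + 4 = _
      rw [this]
      omega
  exact aux g le_rfl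

theorem cc_le (n h m : ℕ) (hh : 2 ≤ h) : cc n h m ≤ fn m := by
  obtain ⟨g, rfl⟩ := Nat.exists_eq_add_of_le' hh
  have s1 : g + 2 - 1 = g + 1 := rfl
  have s2 : g + 2 - 2 = g := rfl
  have r1 : fn (g + 2) = fn (g + 1) + fn g := fn_add_two g
  have l0 : fn g < fn (g + 1) := fn_lt_succ g
  unfold cc
  rw [s1, s2]
  split_ifs with c0 c1 c2 c3
  · omega
  · exact fn_pos m
  · subst c2; omega
  · have c3' : m = g + 1 := by omega
    subst c3'
    omega
  · exact le_rfl

theorem D2e_eq (n h : ℕ) (hn : 9 ≤ n) (hh : 2 ≤ h)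
    (h1 : 2 * fn h ≤ n) (h2 : n < 2 * fn (h + 1)) :
    D2e 1 n = ∑ m ∈ Finset.range (h + 1), cc n h m := by
  unfold D2e
  rw [power_set n h hn hh h1 h2, Set.ncard_coe_finset, Finset.card_image_of_injOn]
  · simp [Finset.card_sigma]
  · rintro ⟨m, j⟩ hx ⟨m', j'⟩ hy hxy
    simp only [Finset.mem_coe, Finset.mem_sigma, Finset.mem_range] at hx hy hxy
    have hl := congrArg List.length hxy
    rw [List.length_rotate, List.length_rotate, Fw_length, Fw_length] at hl
    have hm : m = m' := by
      rcases lt_trichotomy m m' with hlt | heq | hlt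
      · have := fn_lt_succ m
        have := fn_mono (show m + 1 ≤ m' by omega)
        omega
      · exact heq
      · have := fn_lt_succ m'
        have := fn_mono (show m' + 1 ≤ m by omega)
        omega
    subst hm
    have := Fw_rotate_inj m j j' (hx.2.trans_le (cc_le _ _ _ hh))
      (hy.2.trans_le (cc_le _ _ _ hh)) hxy
    subst this
    rfl

/-- The number of distinct (2+ε)-powers in the prefix `F[1,n]` equals
`min (n - f_{h-1} - 6) (f_{h+1} + f_{h-1} - 6)` where `2f_h ≤ n < 2f_{h+1}`, `n ≥ 9`, `h ≥ 2`. -/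
theorem number_of_two_plus_eps_powers_in_prefix (n h : ℕ) (hn : 9 ≤ n) (hh : 2 ≤ h)
    (h1 : 2 * fn h ≤ n) (h2 : n < 2 * fn (h + 1)) :
    (D2e 1 n : ℤ) =
      min ((n : ℤ) - (Nat.fib (h + 1) : ℤ) - 6)
        ((fn (h + 1) : ℤ) + (Nat.fib (h + 1) : ℤ) - 6) := by
  rw [D2e_eq n h hn hh h1 h2]
  obtain ⟨g, rfl⟩ := Nat.exists_eq_add_of_le' hh
  rcases g with _ | g
  · have e : fn (0 + 2 + 1) = 5 := rfl
    rw [e] at h2 ⊢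
    have : n = 9 := by omega
    subst this
    decide
  · have hs := sum_low n g
    have t1 : cc n (g + 3) (g + 2) = max (fn (g + 1) - 2)
        (min (fn (g + 2)) (n - fn (g + 4) - fn (g + 2))) := by
      unfold cc
      rw [if_neg (by omega), if_neg (by omega), if_neg (by omega), if_pos (by omega)]
      rfl
    have t2 : cc n (g + 3) (g + 3) = min (n - 2 * fn (g + 3)) (fn (g + 2) - 2) := by
      unfold cc
      rw [if_neg (by omega), if_neg (by omega), if_pos (by omega)]
      rfl
    have e0 : ∑ m ∈ Finset.range (g + 1 + 2 + 1), cc n (g + 1 + 2) m =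
        ∑ m ∈ Finset.range (g + 2), cc n (g + 3) m + cc n (g + 3) (g + 2)
          + cc n (g + 3) (g + 3) := by
      show ∑ m ∈ Finset.range (g + 2 + 1 + 1), cc n (g + 3) m = _
      rw [Finset.sum_range_succ, Finset.sum_range_succ]
    have e1 : Nat.fib (g + 1 + 2 + 1) = fn (g + 2) := rfl
    have e2 : fn (g + 1 + 2 + 1) = fn (g + 4) := rfl
    have e3 : fn (g + 1 + 2) = fn (g + 3) := rfl
    have f4 : fn (g + 4) = fn (g + 3) + fn (g + 2) := fn_add_two (g + 2)
    have f3 : fn (g + 3) = fn (g + 2) + fn (g + 1) := fn_add_two (g + 1)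
    have f2 : fn (g + 2) = fn (g + 1) + fn g := fn_add_two g
    have f1 : fn 1 ≤ fn (g + 1) := fn_mono (by omega)
    rw [fn_one] at f1
    have f0 := fn_pos g
    rw [e0, t1, t2, e1, e2]
    rw [e2] at h2
    rw [e3] at h1
    clear e0 e1 e2 e3 t1 t2
    generalize ∑ m ∈ Finset.range (g + 2), cc n (g + 3) m = S at hs ⊢
    generalize fn (g + 4) = a4 at *
    generalize fn (g + 3) = a3 at *
    generalize fn (g + 2) = a2 at *
    generalize fn (g + 1) = a1 at *
    generalize fn g = a0 at *
    clear hh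
    rcases le_total n (a4 + a3 - 2 + 2) with hc | hc
    · omega
    · omega
end
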